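/- arXiv:1107.2351 — 2 statements merged into one kernel-verified Lean document; each statement's English description precedes it below -/
import Mathlib

section
/- Let Ω ⊂ ℝⁿ be a bounded open set with C² boundary whose second fundamental form with respect to the outward normal is positive definite (strictly convex), with diameter D. Let q be a convex function, C¹ on the closure of Ω, and let φ₀ be a first Dirichlet eigenfunction of L_q = Δ − q on Ω with eigenvalue λ₀. Then for all x ≠ y in Ω: −(∇log φ₀(y) − ∇log φ₀(x)) · (y − x)/|y − x| ≥ 2(π/D) tan(π|y − x|/(2D)). -/
open scoped RealInnerProductSpace
open Set MeasureTheory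

noncomputable def lap {n : ℕ} (f : EuclideanSpace ℝ (Fin n) → ℝ) (x : EuclideanSpace ℝ (Fin n)) : ℝ :=
  ∑ i, fderiv ℝ (fun y => fderiv ℝ f y (EuclideanSpace.single i 1)) x
      (EuclideanSpace.single i 1)

section
open Filter Topology Asymptotics


/-- Second order Taylor expansion within a convex set. -/
lemma taylor2_aux {E : Type*} [NormedAddCommGroup E] [NormedSpace ℝ E]
    {f : E → ℝ} {C : Set E} (hC : Convex ℝ C)
    {f' : E → E →L[ℝ] ℝ} {f'' : E →L[ℝ] E →L[ℝ] ℝ} {z : E} (hz : z ∈ C)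
    (h1 : ∀ x ∈ C, HasFDerivWithinAt f (f' x) C x) (h2 : HasFDerivWithinAt f' f'' C z)
    {η : ℝ} (hη : 0 < η) :
    ∀ᶠ y in 𝓝[C] z, |f y - f z - f' z (y - z) - (1/2) * f'' (y - z) (y - z)| ≤ η * ‖y - z‖^2 := by
  have h3 := (hasFDerivWithinAt_iff_isLittleO.1 h2).def hη
  rw [eventually_nhdsWithin_iff, Metric.eventually_nhds_iff] at h3 ⊢
  obtain ⟨ε, hε, h3⟩ := h3
  refine ⟨ε, hε, fun y hy hyC => ?_⟩
  have hseg : ∀ s ∈ Icc (0:ℝ) 1, z + s • (y - z) ∈ C := fun s hs =>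
    hC.add_smul_sub_mem hz hyC hs
  set h := y - z with hh
  have hder : ∀ s ∈ Icc (0:ℝ) 1, HasDerivWithinAt
      (fun s : ℝ => f (z + s • h) - s * f' z h - s^2 / 2 * f'' h h)
      (f' (z + s • h) h - f' z h - s * f'' h h) (Icc 0 1) s := by
    intro s hs
    have e1 : HasDerivWithinAt (fun s : ℝ => z + s • h) h (Icc 0 1) s := by
      have := ((hasDerivAt_id s).smul_const h).const_add z
      simpa using this.hasDerivWithinAt
    have e2 := (h1 _ (hseg s hs)).comp_hasDerivWithinAt s e1 (fun t ht => hseg t ht)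
    have e3 : HasDerivWithinAt (fun s : ℝ => s * f' z h) (f' z h) (Icc 0 1) s := by
      simpa using ((hasDerivAt_id s).mul_const (f' z h)).hasDerivWithinAt
    have e4 : HasDerivWithinAt (fun s : ℝ => s^2 / 2 * f'' h h) (s * f'' h h) (Icc 0 1) s := by
      have := ((((hasDerivAt_id s).pow 2).div_const 2).mul_const (f'' h h)).hasDerivWithinAt (s := Icc 0 1)
      refine this.congr_deriv ?_
      simp
    exact (e2.sub e3).sub e4
  have hb : ∀ s ∈ Ico (0:ℝ) 1, ‖f' (z + s • h) h - f' z h - s * f'' h h‖ ≤ η * ‖h‖^2 := by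
    intro s hs
    have hs' : s ∈ Icc (0:ℝ) 1 := ⟨hs.1, hs.2.le⟩
    have hd : dist (z + s • h) z < ε := by
      have : dist (z + s • h) z = |s| * ‖h‖ := by simp [dist_eq_norm, norm_smul]
      rw [this, abs_of_nonneg hs.1]
      have h5 : ‖h‖ < ε := by simpa [dist_eq_norm] using hy
      nlinarith [norm_nonneg h, hs.2]
    have h6 := h3 hd (hseg s hs')
    have h7 : f' (z + s • h) h - f' z h - s * f'' h h
        = (f' (z + s • h) - f' z - f'' (z + s • h - z)) h := by
      simp
    rw [h7]
    refine (ContinuousLinearMap.le_opNorm _ _).trans ?_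
    have h8 : ‖z + s • h - z‖ ≤ ‖h‖ := by
      simp only [add_sub_cancel_left, norm_smul, Real.norm_eq_abs, abs_of_nonneg hs.1]
      nlinarith [norm_nonneg h, hs.2]
    calc _ ≤ (η * ‖z + s • h - z‖) * ‖h‖ := by gcongr
      _ ≤ (η * ‖h‖) * ‖h‖ := by gcongr
      _ = η * ‖h‖^2 := by ring
  have := norm_image_sub_le_of_norm_deriv_le_segment_01' hder hb
  have e : z + (y - z) = y := by abel
  simp only [one_smul, zero_smul, add_zero, Real.norm_eq_abs, hh, e] at this
  convert this using 2
  ring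

lemma taylor2_seq {E : Type*} [NormedAddCommGroup E] [NormedSpace ℝ E]
    {f : E → ℝ} {C : Set E} (hC : Convex ℝ C)
    {f' : E → E →L[ℝ] ℝ} {f'' : E →L[ℝ] E →L[ℝ] ℝ} {z : E} (hz : z ∈ C)
    (h1 : ∀ x ∈ C, HasFDerivWithinAt f (f' x) C x) (h2 : HasFDerivWithinAt f' f'' C z)
    {s : ℕ → ℝ} {u : ℕ → E} {e : E} (hs : ∀ j, 0 < s j) (hs0 : Tendsto s atTop (𝓝 0))
    (hu : Tendsto u atTop (𝓝 e)) (hm : ∀ j, z + s j • u j ∈ C) :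
    Tendsto (fun j => (f (z + s j • u j) - f z - s j * f' z (u j)) / (s j)^2) atTop
      (𝓝 ((1/2) * f'' e e)) := by
  have hy : Tendsto (fun j => z + s j • u j) atTop (𝓝[C] z) := by
    refine tendsto_nhdsWithin_iff.2 ⟨?_, Eventually.of_forall hm⟩
    have := (hs0.smul hu).const_add z
    simpa using this
  have hq : Tendsto (fun j => (1/2) * f'' (u j) (u j)) atTop (𝓝 ((1/2) * f'' e e)) := by
    have : Continuous fun w : E => (1/2) * f'' w w := by fun_prop
    exact (this.tendsto e).comp hu
  have hdiff : Tendsto (fun j => (f (z + s j • u j) - f z - s j * f' z (u j)) / (s j)^2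
      - (1/2) * f'' (u j) (u j)) atTop (𝓝 0) := by
    rw [Metric.tendsto_atTop']
    intro ε hε
    set M := ‖e‖ + 1
    have hM : 0 < M := by positivity
    have hev := hy.eventually (taylor2_aux hC hz h1 h2 (η := ε / (2 * M^2)) (by positivity))
    have hev2 : ∀ᶠ j in atTop, ‖u j‖ < M :=
      hu.norm.eventually (gt_mem_nhds (by simp [M]))
    obtain ⟨N, hN⟩ := eventually_atTop.1 (hev.and hev2)
    refine ⟨N, fun j hj => ?_⟩
    obtain ⟨ha, hb⟩ := hN j hj.le
    have hsj := hs j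
    simp only [add_sub_cancel_left, map_smul, smul_eq_mul, norm_smul,
      smul_apply, Real.norm_eq_abs, abs_of_pos hsj] at ha
    rw [dist_zero_right, Real.norm_eq_abs]
    have e1 : (f (z + s j • u j) - f z - s j * f' z (u j)) / (s j)^2
      - (1/2) * f'' (u j) (u j) = (f (z + s j • u j) - f z - s j * f' z (u j)
        - 1/2 * (s j * (s j * f'' (u j) (u j)))) / (s j)^2 := by
      field_simp
    rw [e1, abs_div, abs_of_pos (by positivity : 0 < (s j)^2), div_lt_iff₀ (by positivity)]
    refine ha.trans_lt ?_
    have h9 : ‖u j‖^2 ≤ M^2 := by gcongr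
    calc ε / (2 * M^2) * (s j * ‖u j‖)^2 = ε / (2 * M^2) * (s j)^2 * ‖u j‖^2 := by ring
      _ ≤ ε / (2 * M^2) * (s j)^2 * M^2 := by gcongr
      _ = ε * (s j)^2 / 2 := by field_simp
      _ < ε * (s j)^2 := by nlinarith [mul_pos hε (pow_pos hsj 2)]
  have := hdiff.add hq
  simpa using this

/-- Bundle of the hypotheses on the domain and the eigenfunction. -/
structure BD {E : Type*} [NormedAddCommGroup E] [InnerProductSpace ℝ E] [FiniteDimensional ℝ E]
    (Ω : Set E) (ρ φ : E → ℝ) : Prop where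
  hΩ : IsOpen Ω
  hbd : Bornology.IsBounded Ω
  hconv : Convex ℝ (closure Ω)
  hne : Ω.Nonempty
  hρ : ContDiff ℝ 2 ρ
  hΩρ : Ω = {x | ρ x < 0}
  hfr : frontier Ω = {x | ρ x = 0}
  hν : ∀ x ∈ frontier Ω, gradient ρ x ≠ 0
  hsc : ∀ x ∈ frontier Ω, ∀ v : E, v ≠ 0 → ⟪gradient ρ x, v⟫ = 0 →
      0 < fderiv ℝ (fderiv ℝ ρ) x v v
  hφC : ContDiffOn ℝ 2 φ (closure Ω)
  hφpos : ∀ x ∈ Ω, 0 < φ x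
  hφbd : ∀ x ∈ frontier Ω, φ x = 0
  hφν : ∀ x ∈ frontier Ω, fderivWithin ℝ φ (closure Ω) x (gradient ρ x) < 0

namespace BD

variable {E : Type*} [NormedAddCommGroup E] [InnerProductSpace ℝ E] [FiniteDimensional ℝ E]
    {Ω : Set E} {ρ φ : E → ℝ}

lemma grad (B : BD Ω ρ φ) (x v : E) : ⟪gradient ρ x, v⟫ = fderiv ℝ ρ x v := by
  simp [gradient]

lemma mem_closure_iff (B : BD Ω ρ φ) {x : E} : x ∈ closure Ω ↔ ρ x ≤ 0 := by
  rw [closure_eq_self_union_frontier, B.hfr]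
  nth_rw 1 [B.hΩρ]
  simp [le_iff_lt_or_eq]

lemma fr_of (B : BD Ω ρ φ) {x : E} (h : x ∈ closure Ω) (h' : x ∉ Ω) : x ∈ frontier Ω := by
  rw [frontier, B.hΩ.interior_eq]; exact ⟨h, h'⟩

lemma fr_zero (B : BD Ω ρ φ) {x : E} (h : x ∈ frontier Ω) : ρ x = 0 := by
  rw [B.hfr] at h; exact h

lemma fr_cl (B : BD Ω ρ φ) {x : E} (h : x ∈ frontier Ω) : x ∈ closure Ω := frontier_subset_closure h

lemma int_cl (B : BD Ω ρ φ) : interior (closure Ω) = Ω := by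
  apply Subset.antisymm _ B.hΩ.subset_interior_closure
  intro x hx
  by_contra hxΩ
  have hf := B.fr_of (interior_subset hx) hxΩ
  have hmax : IsLocalMax ρ x := by
    filter_upwards [mem_interior_iff_mem_nhds.1 hx] with y hy
    rw [B.fr_zero hf]; exact B.mem_closure_iff.1 hy
  apply B.hν x hf
  simp [gradient, hmax.fderiv_eq_zero]

lemma convex (B : BD Ω ρ φ) : Convex ℝ Ω := by
  rw [← B.int_cl]; exact B.hconv.interior

lemma uniq (B : BD Ω ρ φ) : UniqueDiffOn ℝ (closure Ω) :=
  uniqueDiffOn_convex B.hconv (by rw [B.int_cl]; exact B.hne)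

lemma line_deriv (B : BD Ω ρ φ) (x v : E) (s : ℝ) :
    HasDerivAt (fun s : ℝ => ρ (x + s • v)) (fderiv ℝ ρ (x + s • v) v) s := by
  have e1 : HasDerivAt (fun s : ℝ => x + s • v) v s := by
    simpa using ((hasDerivAt_id s).smul_const v).const_add x
  have hd : DifferentiableAt ℝ ρ (x + s • v) := (B.hρ.differentiable (by norm_num)) _
  exact hd.hasFDerivAt.comp_hasDerivAt s e1

lemma rho_deriv2 (B : BD Ω ρ φ) (x : E) : HasFDerivAt (fderiv ℝ ρ) (fderiv ℝ (fderiv ℝ ρ) x) x := by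
  have : ContDiff ℝ 1 (fderiv ℝ ρ) := B.hρ.fderiv_right (by norm_num)
  exact (this.differentiable (by norm_num) x).hasFDerivAt

lemma rho_deriv1 (B : BD Ω ρ φ) (x : E) : HasFDerivAt ρ (fderiv ℝ ρ x) x :=
  (B.hρ.differentiable (by norm_num) x).hasFDerivAt

/-- strict supporting hyperplane -/
lemma support (B : BD Ω ρ φ) {x y : E} (hx : x ∈ frontier Ω) (hy : y ∈ closure Ω) (hxy : y ≠ x) :
    ⟪gradient ρ x, y - x⟫ < 0 := by
  set v := y - x with hv
  have hv0 : v ≠ 0 := sub_ne_zero.2 hxy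
  have hseg : ∀ s ∈ Icc (0:ℝ) 1, x + s • v ∈ closure Ω := fun s hs =>
    B.hconv.add_smul_sub_mem (B.fr_cl hx) hy hs
  set s : ℕ → ℝ := fun j => 1 / ((j:ℝ) + 1) with hs
  have hspos : ∀ j, 0 < s j := fun j => by positivity
  have hs1 : ∀ j, s j ≤ 1 := fun j => by
    rw [hs]; simp only; rw [div_le_one (by positivity)]; linarith [(Nat.cast_nonneg j : (0:ℝ) ≤ j)]
  have hs0 : Tendsto s atTop (𝓝 0) := tendsto_one_div_add_atTop_nhds_zero_nat
  have hle : ∀ j, ρ (x + s j • v) ≤ 0 := fun j =>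
    B.mem_closure_iff.1 (hseg _ ⟨(hspos j).le, hs1 j⟩)
  have key := taylor2_seq (f := ρ) (C := univ) (f' := fderiv ℝ ρ) (z := x) convex_univ (mem_univ x)
    (fun x _ => (B.rho_deriv1 x).hasFDerivWithinAt) (B.rho_deriv2 x).hasFDerivWithinAt
    hspos hs0 (tendsto_const_nhds (x := v)) (fun _ => mem_univ _)
  have hle' : ⟪gradient ρ x, v⟫ ≤ 0 := by
    by_contra hcon
    push Not at hcon
    rw [B.grad] at hcon
    have h2 := key.mul hs0
    simp only [mul_zero] at h2
    have h3 : Tendsto (fun j => (ρ (x + s j • v)) / s j - fderiv ℝ ρ x v) atTop (𝓝 0) := by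
      refine h2.congr (fun j => ?_)
      have := (hspos j).ne'
      rw [B.fr_zero hx]; field_simp; ring
    have h4 : ∀ j, (ρ (x + s j • v)) / s j - fderiv ℝ ρ x v ≤ - fderiv ℝ ρ x v := fun j => by
      have := div_nonpos_of_nonpos_of_nonneg (hle j) (hspos j).le
      linarith
    have := le_of_tendsto h3 (Eventually.of_forall h4)
    linarith
  refine lt_of_le_of_ne hle' fun h0 => ?_
  have hpos := B.hsc x hx v hv0 h0
  rw [B.grad] at h0
  have h4 : ∀ j, (ρ (x + s j • v) - ρ x - s j * fderiv ℝ ρ x v) / (s j)^2 ≤ 0 := fun j => by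
    rw [h0, B.fr_zero hx]
    have := hle j
    apply div_nonpos_of_nonpos_of_nonneg _ (by positivity)
    linarith
  have := le_of_tendsto key (Eventually.of_forall h4)
  linarith

lemma between (B : BD Ω ρ φ) {x y : E} (hx : x ∈ closure Ω) (hy : y ∈ closure Ω) (hxy : x ≠ y) {t : ℝ}
    (ht0 : 0 < t) (ht1 : t < 1) : x + t • (y - x) ∈ Ω := by
  by_contra hcon
  set z := x + t • (y - x) with hz
  have hzC : z ∈ closure Ω := B.hconv.add_smul_sub_mem hx hy ⟨ht0.le, ht1.le⟩
  have hzf := B.fr_of hzC hcon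
  have e1 : x - z = (-t) • (y - x) := by rw [hz]; module
  have e2 : y - z = (1 - t) • (y - x) := by rw [hz]; module
  have n0 : y - x ≠ 0 := sub_ne_zero.2 hxy.symm
  have n1 : x ≠ z := by
    rw [← sub_ne_zero, e1]; exact smul_ne_zero (by linarith) n0
  have n2 : y ≠ z := by
    rw [← sub_ne_zero, e2]; exact smul_ne_zero (by linarith) n0
  have h1 := B.support hzf hx n1
  have h2 := B.support hzf hy n2
  rw [e1, inner_smul_right] at h1
  rw [e2, inner_smul_right] at h2
  have a1 : 0 < ⟪gradient ρ z, y - x⟫ := by nlinarith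
  have a2 : ⟪gradient ρ z, y - x⟫ < 0 := by nlinarith
  linarith

/-- boundary points approaching z in a tangential direction -/
lemma bdry_seq (B : BD Ω ρ φ) {z e : E} (hz : z ∈ frontier Ω) (he : e ≠ 0) (ht : ⟪gradient ρ z, e⟫ = 0) :
    ∃ s c : ℕ → ℝ, (∀ j, 0 < s j) ∧ Tendsto s atTop (𝓝 0) ∧ Tendsto c atTop (𝓝 0) ∧
      ∀ j, z + s j • (e - c j • gradient ρ z) ∈ frontier Ω := by
  set N := gradient ρ z with hN
  have hN0 : 0 < ⟪N, N⟫ := by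
    rw [real_inner_self_eq_norm_sq]; have := B.hν z hz; positivity
  have hcont : Continuous ρ := B.hρ.continuous
  have main : ∀ σ > 0, ∀ s0 > 0, ∃ s c : ℝ, 0 < s ∧ s < s0 ∧ 0 ≤ c ∧ c ≤ σ ∧
      z + s • (e - c • N) ∈ frontier Ω := by
    intro σ hσ s0 hs0
    have hd := B.line_deriv z (e - σ • N) 0
    simp only [zero_smul, add_zero, ← B.grad] at hd
    rw [← hN, inner_sub_right, ht, inner_smul_right] at hd
    have hneg : 0 - σ * ⟪N, N⟫ < 0 := by nlinarith
    have hsl := hd.hasDerivWithinAt (s := Ioi 0)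
    rw [hasDerivWithinAt_iff_tendsto_slope' (by simp)] at hsl
    have hev := hsl.eventually (gt_mem_nhds hneg)
    have hev2 : ∀ᶠ s in 𝓝[>] (0:ℝ), s < s0 := nhdsWithin_le_nhds (gt_mem_nhds hs0)
    have hev3 : ∀ᶠ s in 𝓝[>] (0:ℝ), 0 < s := self_mem_nhdsWithin
    obtain ⟨s, ⟨hs1, hs2⟩, hs3⟩ := ((hev.and hev2).and hev3).exists
    have hlt : ρ (z + s • (e - σ • N)) < 0 := by
      simp only [slope, vsub_eq_sub, zero_smul, add_zero, sub_zero, smul_eq_mul,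
        B.fr_zero hz] at hs1
      by_contra hcon
      push Not at hcon
      have : 0 ≤ s⁻¹ * ρ (z + s • (e - σ • N)) := by positivity
      linarith
    have hge : 0 ≤ ρ (z + s • (e - (0:ℝ) • N)) := by
      by_contra hcon
      push Not at hcon
      have hmem := B.mem_closure_iff.2 hcon.le
      have hne : z + s • (e - (0:ℝ) • N) ≠ z := by simp [hs3.ne', he]
      have := B.support hz hmem hne
      simp [inner_smul_right, ← hN, ht] at this
    have hcf : ContinuousOn (fun c : ℝ => ρ (z + s • (e - c • N))) (Icc 0 σ) := by
      apply Continuous.continuousOn; fun_prop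
    obtain ⟨c, hc, hc0⟩ := intermediate_value_Icc' hσ.le hcf ⟨hlt.le, hge⟩
    exact ⟨s, c, hs3, hs2, hc.1, hc.2, by rw [B.hfr]; exact hc0⟩
  have hp : ∀ j : ℕ, (0:ℝ) < 1 / ((j:ℝ) + 1) := fun j => by positivity
  choose s c h1 h2 h3 h4 h5 using fun j : ℕ => main _ (hp j) _ (hp j)
  refine ⟨s, c, h1, ?_, ?_, h5⟩
  · exact squeeze_zero (fun j => (h1 j).le) (fun j => (h2 j).le) tendsto_one_div_add_atTop_nhds_zero_nat
  · exact squeeze_zero h3 h4 tendsto_one_div_add_atTop_nhds_zero_nat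

lemma phi_deriv1 (B : BD Ω ρ φ) {x : E} (hx : x ∈ closure Ω) :
    HasFDerivWithinAt φ (fderivWithin ℝ φ (closure Ω) x) (closure Ω) x :=
  (B.hφC.differentiableOn (by norm_num) x hx).hasFDerivWithinAt

lemma phi_C1 (B : BD Ω ρ φ) : ContDiffOn ℝ 1 (fderivWithin ℝ φ (closure Ω)) (closure Ω) :=
  B.hφC.fderivWithin B.uniq (by norm_num)

lemma phi_deriv2 (B : BD Ω ρ φ) {x : E} (hx : x ∈ closure Ω) :
    HasFDerivWithinAt (fderivWithin ℝ φ (closure Ω))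
      (fderivWithin ℝ (fderivWithin ℝ φ (closure Ω)) (closure Ω) x) (closure Ω) x :=
  (B.phi_C1.differentiableOn (by norm_num) x hx).hasFDerivWithinAt

lemma phi_cont1 (B : BD Ω ρ φ) : ContinuousOn (fderivWithin ℝ φ (closure Ω)) (closure Ω) := B.phi_C1.continuousOn

lemma phi_cont2 (B : BD Ω ρ φ) : ContinuousOn (fderivWithin ℝ (fderivWithin ℝ φ (closure Ω)) (closure Ω)) (closure Ω) :=
  B.phi_C1.continuousOn_fderivWithin B.uniq (by norm_num)

lemma tang_zero (B : BD Ω ρ φ) {z e : E} (hz : z ∈ frontier Ω) (ht : ⟪gradient ρ z, e⟫ = 0) :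
    fderivWithin ℝ φ (closure Ω) z e = 0 := by
  rcases eq_or_ne e 0 with rfl | he
  · simp
  obtain ⟨s, c, hs, hs0, hc0, hm⟩ := B.bdry_seq hz he ht
  have hu : Tendsto (fun j => e - c j • gradient ρ z) atTop (𝓝 e) := by
    simpa using (hc0.smul_const (gradient ρ z)).const_sub e
  have key := taylor2_seq (f := φ) B.hconv (B.fr_cl hz)
    (fun x hx => B.phi_deriv1 hx) (B.phi_deriv2 (B.fr_cl hz)) hs hs0 hu (fun j => B.fr_cl (hm j))
  have h2 := key.mul hs0
  simp only [mul_zero] at h2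
  have h3 : Tendsto (fun j => - fderivWithin ℝ φ (closure Ω) z (e - c j • gradient ρ z)) atTop (𝓝 0) := by
    refine h2.congr (fun j => ?_)
    have := (hs j).ne'
    rw [B.hφbd _ hz, B.hφbd _ (hm j)]; field_simp; ring
  have h4 : Tendsto (fun j => - fderivWithin ℝ φ (closure Ω) z (e - c j • gradient ρ z)) atTop
      (𝓝 (- fderivWithin ℝ φ (closure Ω) z e)) :=
    (((fderivWithin ℝ φ (closure Ω) z).continuous.tendsto e).comp hu).neg
  have := tendsto_nhds_unique h3 h4
  linarith

lemma dphi_eq (B : BD Ω ρ φ) {z : E} (hz : z ∈ frontier Ω) (v : E) :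
    fderivWithin ℝ φ (closure Ω) z v =
      ⟪gradient ρ z, v⟫ / ⟪gradient ρ z, gradient ρ z⟫ *
        fderivWithin ℝ φ (closure Ω) z (gradient ρ z) := by
  set N := gradient ρ z with hN
  have hN0 : 0 < ⟪N, N⟫ := by
    rw [real_inner_self_eq_norm_sq]; have := B.hν z hz; positivity
  have h0 := B.tang_zero hz (e := v - (⟪N, v⟫ / ⟪N, N⟫) • N) (by
    rw [inner_sub_right, inner_smul_right, ← hN]; field_simp; ring)
  rw [map_sub, map_smul, smul_eq_mul] at h0
  linarith

lemma dphi_pos (B : BD Ω ρ φ) {z v : E} (hz : z ∈ frontier Ω) (hv : ⟪gradient ρ z, v⟫ < 0) :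
    0 < fderivWithin ℝ φ (closure Ω) z v := by
  rw [B.dphi_eq hz]
  have hN0 : 0 < ⟪gradient ρ z, gradient ρ z⟫ := by
    rw [real_inner_self_eq_norm_sq]; have := B.hν z hz; positivity
  exact mul_pos_of_neg_of_neg (div_neg_of_neg_of_pos hv hN0) (B.hφν z hz)

lemma d2phi_neg (B : BD Ω ρ φ) {z e : E} (hz : z ∈ frontier Ω) (he : e ≠ 0)
    (h0 : fderivWithin ℝ φ (closure Ω) z e = 0) :
    fderivWithin ℝ (fderivWithin ℝ φ (closure Ω)) (closure Ω) z e e < 0 := by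
  have hN0 : 0 < ⟪gradient ρ z, gradient ρ z⟫ := by
    rw [real_inner_self_eq_norm_sq]; have := B.hν z hz; positivity
  have hφN := B.hφν z hz
  have ht : ⟪gradient ρ z, e⟫ = 0 := by
    rw [B.dphi_eq hz] at h0
    rcases mul_eq_zero.1 h0 with h | h
    · rcases div_eq_zero_iff.1 h with h | h
      · exact h
      · linarith
    · linarith
  obtain ⟨s, c, hs, hs0, hc0, hm⟩ := B.bdry_seq hz he ht
  have hu : Tendsto (fun j => e - c j • gradient ρ z) atTop (𝓝 e) := by
    simpa using (hc0.smul_const (gradient ρ z)).const_sub e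
  have key := taylor2_seq (f := φ) B.hconv (B.fr_cl hz)
    (fun x hx => B.phi_deriv1 hx) (B.phi_deriv2 (B.fr_cl hz)) hs hs0 hu (fun j => B.fr_cl (hm j))
  have key2 := taylor2_seq (f := ρ) (C := univ) (f' := fderiv ℝ ρ) (z := z) convex_univ (mem_univ z)
    (fun x _ => (B.rho_deriv1 x).hasFDerivWithinAt) (B.rho_deriv2 z).hasFDerivWithinAt
    hs hs0 hu (fun _ => mem_univ _)
  have hpos := B.hsc z hz e he ht
  have e1 : ∀ j, (φ (z + s j • (e - c j • gradient ρ z)) - φ z -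
      s j * fderivWithin ℝ φ (closure Ω) z (e - c j • gradient ρ z)) / (s j)^2
      = (c j / s j) * fderivWithin ℝ φ (closure Ω) z (gradient ρ z) := fun j => by
    rw [B.hφbd _ hz, B.hφbd _ (hm j), map_sub, h0, map_smul, smul_eq_mul]
    have := (hs j).ne'
    field_simp; ring
  have e2 : ∀ j, (ρ (z + s j • (e - c j • gradient ρ z)) - ρ z -
      s j * fderiv ℝ ρ z (e - c j • gradient ρ z)) / (s j)^2
      = (c j / s j) * ⟪gradient ρ z, gradient ρ z⟫ := fun j => by
    rw [B.fr_zero hz, B.fr_zero (hm j), ← B.grad, inner_sub_right, ht, inner_smul_right]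
    have := (hs j).ne'
    field_simp; ring
  have k1 := key.congr e1
  have k2 := (key2.congr e2).mul_const
    (fderivWithin ℝ φ (closure Ω) z (gradient ρ z) / ⟪gradient ρ z, gradient ρ z⟫)
  have k3 := k2.congr (f₂ := fun j => (c j / s j) * fderivWithin ℝ φ (closure Ω) z (gradient ρ z))
    (fun j => by field_simp)
  have := tendsto_nhds_unique k1 k3
  have : (1/2) * fderiv ℝ (fderiv ℝ ρ) z e e *
    (fderivWithin ℝ φ (closure Ω) z (gradient ρ z) / ⟪gradient ρ z, gradient ρ z⟫) < 0 :=
    mul_neg_of_pos_of_neg (by positivity) (div_neg_of_neg_of_pos hφN hN0)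
  linarith

end BD

lemma tendsto_clm_app {X E F : Type*} [NormedAddCommGroup E] [NormedSpace ℝ E]
    [NormedAddCommGroup F] [NormedSpace ℝ F] {l : Filter X} {f : X → E →L[ℝ] F} {g : X → E}
    {a : E →L[ℝ] F} {b : E} (hf : Tendsto f l (𝓝 a)) (hg : Tendsto g l (𝓝 b)) :
    Tendsto (fun x => f x (g x)) l (𝓝 (a b)) :=
  (isBoundedBilinearMap_apply.continuous.tendsto (a, b)).comp (hf.prodMk_nhds hg)

namespace BD

variable {E : Type*} [NormedAddCommGroup E] [InnerProductSpace ℝ E] [FiniteDimensional ℝ E]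
    {Ω : Set E} {ρ φ : E → ℝ}

lemma cl_nhds (B : BD Ω ρ φ) {x : E} (hx : x ∈ Ω) : closure Ω ∈ 𝓝 x :=
  mem_of_superset (B.hΩ.mem_nhds hx) subset_closure

lemma fdw_eq (B : BD Ω ρ φ) {x : E} (hx : x ∈ Ω) :
    fderivWithin ℝ φ (closure Ω) x = fderiv ℝ φ x := fderivWithin_of_mem_nhds (B.cl_nhds hx)

lemma fdw2_eq (B : BD Ω ρ φ) {x : E} (hx : x ∈ Ω) :
    fderivWithin ℝ (fderivWithin ℝ φ (closure Ω)) (closure Ω) x = fderiv ℝ (fderiv ℝ φ) x := by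
  rw [fderivWithin_of_mem_nhds (B.cl_nhds hx)]
  apply Filter.EventuallyEq.fderiv_eq
  filter_upwards [B.hΩ.mem_nhds hx] with y hy using B.fdw_eq hy

lemma hasF1 (B : BD Ω ρ φ) {x : E} (hx : x ∈ Ω) : HasFDerivAt φ (fderiv ℝ φ x) x := by
  rw [← B.fdw_eq hx]
  exact (B.phi_deriv1 (subset_closure hx)).hasFDerivAt (B.cl_nhds hx)

lemma hasF2 (B : BD Ω ρ φ) {x : E} (hx : x ∈ Ω) :
    HasFDerivAt (fderiv ℝ φ) (fderiv ℝ (fderiv ℝ φ) x) x := by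
  rw [← B.fdw2_eq hx]
  refine ((B.phi_deriv2 (subset_closure hx)).hasFDerivAt (B.cl_nhds hx)).congr_of_eventuallyEq ?_
  filter_upwards [B.hΩ.mem_nhds hx] with y hy using (B.fdw_eq hy).symm

lemma v_contAt (B : BD Ω ρ φ) {x : E} (hx : x ∈ Ω) : ContinuousAt (fun z => Real.log (φ z)) x :=
  (B.hasF1 hx).continuousAt.log (B.hφpos x hx).ne'

lemma line1 (B : BD Ω ρ φ) {z ξ : E} {s : ℝ} (h : z + s • ξ ∈ Ω) :
    HasDerivAt (fun s : ℝ => Real.log (φ (z + s • ξ)))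
      (fderiv ℝ φ (z + s • ξ) ξ / φ (z + s • ξ)) s := by
  have e1 : HasDerivAt (fun s : ℝ => z + s • ξ) ξ s := by
    simpa using ((hasDerivAt_id s).smul_const ξ).const_add z
  exact ((B.hasF1 h).comp_hasDerivAt s e1).log (B.hφpos _ h).ne'

lemma line2 (B : BD Ω ρ φ) {z ξ : E} {s : ℝ} (h : z + s • ξ ∈ Ω) :
    HasDerivAt (fun s : ℝ => fderiv ℝ φ (z + s • ξ) ξ / φ (z + s • ξ))
      (fderiv ℝ (fderiv ℝ φ) (z + s • ξ) ξ ξ / φ (z + s • ξ)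
        - (fderiv ℝ φ (z + s • ξ) ξ / φ (z + s • ξ))^2) s := by
  have e1 : HasDerivAt (fun s : ℝ => z + s • ξ) ξ s := by
    simpa using ((hasDerivAt_id s).smul_const ξ).const_add z
  have e2 := (B.hasF1 h).comp_hasDerivAt s e1
  have e3 := (B.hasF2 h).comp_hasDerivAt s e1
  have e4 : HasDerivAt (fun s : ℝ => fderiv ℝ φ (z + s • ξ) ξ)
      (fderiv ℝ (fderiv ℝ φ) (z + s • ξ) ξ ξ) s := by
    simpa using e3.clm_apply (hasDerivAt_const s ξ)
  have hp := (B.hφpos _ h).ne'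
  refine (e4.div e2 hp).congr_deriv ?_
  simp only [Function.comp]
  field_simp

lemma phi_nonneg (B : BD Ω ρ φ) {x : E} (hx : x ∈ closure Ω) : 0 ≤ φ x := by
  by_cases h : x ∈ Ω
  · exact (B.hφpos x h).le
  · exact (B.hφbd x (B.fr_of hx h)).ge

lemma near_neg (B : BD Ω ρ φ) {z : E} (hz : z ∈ frontier Ω) :
    ∀ᶠ x in 𝓝 z, ∀ e ∈ Metric.sphere (0:E) 1, x ∈ closure Ω →
      φ x * fderivWithin ℝ (fderivWithin ℝ φ (closure Ω)) (closure Ω) x e e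
        - (fderivWithin ℝ φ (closure Ω) x e)^2 ≤ 0 := by
  apply (isCompact_sphere (0:E) 1).eventually_forall_of_forall_eventually
  intro e he
  have he0 : e ≠ 0 := by
    rintro rfl; simp at he
  have hzC := B.fr_cl hz
  have hfst : Tendsto (Prod.fst : E × E → E) (𝓝[Prod.fst ⁻¹' (closure Ω)] (z, e)) (𝓝[closure Ω] z) := by
    refine tendsto_nhdsWithin_iff.2 ⟨(continuous_fst.tendsto (z,e)).mono_left nhdsWithin_le_nhds, ?_⟩
    exact self_mem_nhdsWithin
  have hsnd : Tendsto (Prod.snd : E × E → E) (𝓝[Prod.fst ⁻¹' (closure Ω)] (z, e)) (𝓝 e) :=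
    (continuous_snd.tendsto (z,e)).mono_left nhdsWithin_le_nhds
  have c0 : Tendsto (fun w : E × E => φ w.1) (𝓝[Prod.fst ⁻¹' (closure Ω)] (z, e)) (𝓝 (φ z)) :=
    (B.hφC.continuousOn z hzC).tendsto.comp hfst
  have c1 : Tendsto (fun w : E × E => fderivWithin ℝ φ (closure Ω) w.1 w.2)
      (𝓝[Prod.fst ⁻¹' (closure Ω)] (z, e)) (𝓝 (fderivWithin ℝ φ (closure Ω) z e)) :=
    tendsto_clm_app ((B.phi_cont1 z hzC).tendsto.comp hfst) hsnd
  have c2 : Tendsto (fun w : E × E =>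
      fderivWithin ℝ (fderivWithin ℝ φ (closure Ω)) (closure Ω) w.1 w.2 w.2)
      (𝓝[Prod.fst ⁻¹' (closure Ω)] (z, e))
      (𝓝 (fderivWithin ℝ (fderivWithin ℝ φ (closure Ω)) (closure Ω) z e e)) :=
    tendsto_clm_app (tendsto_clm_app ((B.phi_cont2 z hzC).tendsto.comp hfst) hsnd) hsnd
  suffices h : ∀ᶠ w : E × E in 𝓝[Prod.fst ⁻¹' (closure Ω)] (z, e),
      φ w.1 * fderivWithin ℝ (fderivWithin ℝ φ (closure Ω)) (closure Ω) w.1 w.2 w.2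
        - (fderivWithin ℝ φ (closure Ω) w.1 w.2)^2 ≤ 0 by
    rw [eventually_nhdsWithin_iff] at h
    exact h
  by_cases h0 : fderivWithin ℝ φ (closure Ω) z e = 0
  · have hneg := B.d2phi_neg hz he0 h0
    filter_upwards [c2.eventually (gt_mem_nhds hneg), self_mem_nhdsWithin] with w hw hwC
    have := B.phi_nonneg hwC
    nlinarith [sq_nonneg (fderivWithin ℝ φ (closure Ω) w.1 w.2)]
  · have hlim := (c0.mul c2).sub (c1.pow 2)
    rw [B.hφbd z hz, zero_mul, zero_sub] at hlim
    have hneg : -(fderivWithin ℝ φ (closure Ω) z e)^2 < 0 := by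
      have : 0 < (fderivWithin ℝ φ (closure Ω) z e)^2 := by positivity
      linarith
    filter_upwards [hlim.eventually (gt_mem_nhds hneg)] with w hw using hw.le

lemma seg_mem (B : BD Ω ρ φ) {m u : E} (h1 : m + u ∈ Ω) (h2 : m - u ∈ Ω) {t : ℝ}
    (ht : t ∈ Icc (-1:ℝ) 1) : m + t • u ∈ Ω := by
  have := B.convex h1 h2 (a := (1+t)/2) (b := (1-t)/2) (by linarith [ht.1]) (by linarith [ht.2])
    (by ring)
  convert this using 1
  module

lemma seg_mem' (B : BD Ω ρ φ) {m u : E} (h1 : m + u ∈ Ω) (h2 : m - u ∈ Ω) {t : ℝ}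
    (ht : t ∈ Icc (-1:ℝ) 1) : m - t • u ∈ Ω := by
  have := B.seg_mem h1 h2 (t := -t) ⟨by linarith [ht.2], by linarith [ht.1]⟩
  convert this using 1
  module

lemma near_conc (B : BD Ω ρ φ) {z : E} (hz : z ∈ frontier Ω) :
    ∃ r > 0, ∀ m u : E, m + u ∈ Ω → m - u ∈ Ω → m + u ∈ Metric.ball z r → m - u ∈ Metric.ball z r →
      ∀ t ∈ Icc (0:ℝ) 1, Real.log (φ (m + u)) + Real.log (φ (m - u)) ≤
        Real.log (φ (m + t • u)) + Real.log (φ (m - t • u)) := by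
  obtain ⟨r, hr, H⟩ := Metric.eventually_nhds_iff.1 (B.near_neg hz)
  refine ⟨r, hr, fun m u h1 h2 h3 h4 t ht => ?_⟩
  have hmem : ∀ s ∈ Icc (-1:ℝ) 1, m + s • u ∈ Ω := fun s hs => B.seg_mem h1 h2 hs
  have hball : ∀ s ∈ Icc (-1:ℝ) 1, m + s • u ∈ Metric.ball z r := by
    intro s hs
    have := (convex_ball z r) h3 h4 (a := (1+s)/2) (b := (1-s)/2) (by linarith [hs.1])
      (by linarith [hs.2]) (by ring)
    convert this using 1
    module
  have hc : ConcaveOn ℝ (Icc (-1:ℝ) 1) (fun s : ℝ => Real.log (φ (m + s • u))) := by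
    apply concaveOn_of_hasDerivWithinAt2_nonpos (convex_Icc _ _)
    · intro s hs
      exact (B.line1 (hmem s hs)).continuousAt.continuousWithinAt
    · intro s hs
      exact (B.line1 (hmem s (interior_subset hs))).hasDerivWithinAt
    · intro s hs
      exact (B.line2 (hmem s (interior_subset hs))).hasDerivWithinAt
    · intro s hs
      have hs := interior_subset hs
      have hx := hmem s hs
      have hp := B.hφpos _ hx
      rcases eq_or_ne u 0 with hu | hu
      · simp [hu]
      have hu' : 0 < ‖u‖ := norm_pos_iff.2 hu
      have := H (hball s hs) (‖u‖⁻¹ • u) (by simp [norm_smul, hu'.ne']) (subset_closure hx)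
      rw [B.fdw_eq hx, B.fdw2_eq hx] at this
      simp only [map_smul, smul_apply, smul_eq_mul] at this
      set X := fderiv ℝ (fderiv ℝ φ) (m + s • u) u u
      set Y := fderiv ℝ φ (m + s • u) u
      set F := φ (m + s • u)
      have e : F * (‖u‖⁻¹ * (‖u‖⁻¹ * X)) - (‖u‖⁻¹ * Y)^2 = (‖u‖⁻¹)^2 * (F * X - Y^2) := by ring
      rw [e] at this
      have h5 : F * X - Y^2 ≤ 0 := by
        by_contra hcon
        push Not at hcon
        have : 0 < (‖u‖⁻¹)^2 * (F * X - Y^2) := by positivity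
        linarith
      have e2 : X / F - (Y / F)^2 = (F * X - Y^2) / F^2 := by field_simp
      rw [e2]
      exact div_nonpos_of_nonpos_of_nonneg h5 (by positivity)
  have m1 : (1:ℝ) ∈ Icc (-1:ℝ) 1 := by simp
  have m2 : (-1:ℝ) ∈ Icc (-1:ℝ) 1 := by simp
  have p1 : (0:ℝ) ≤ (1+t)/2 := by linarith [ht.1]
  have p2 : (0:ℝ) ≤ (1-t)/2 := by linarith [ht.2]
  have a1 := hc.2 m1 m2 p1 p2 (by ring)
  have a2 := hc.2 m1 m2 p2 p1 (by ring)
  have i1 : m + ((1+t)/2 * 1 + (1-t)/2 * (-1)) • u = m + t • u := by module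
  have i2 : m + ((1-t)/2 * 1 + (1+t)/2 * (-1)) • u = m - t • u := by module
  have i3 : m + (-1:ℝ) • u = m - u := by module
  simp only [smul_eq_mul, i1, i2, i3, one_smul] at a1 a2
  linarith

/-- L1 -/
lemma br1 (B : BD Ω ρ φ) {m u : E} {t : ℝ} (h1 : m + u ∈ closure Ω) (h2 : m - u ∈ closure Ω)
    (hu : u ≠ 0) (ht0 : 0 ≤ t) (ht1 : t < 1) (h : m + u ∈ Ω) :
    ∃ M : ℝ, ∀ᶠ p : E × E × ℝ in 𝓝 (m, u, t),
      Real.log (φ (p.1 + p.2.1)) - Real.log (φ (p.1 + p.2.2 • p.2.1)) < M := by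
  have hin : m + t • u ∈ Ω := by
    have := B.between h1 h2 (x := m + u) (y := m - u) (t := (1 - t)/2) (by
      intro h; apply hu; have : (2:ℝ) • u = 0 := by
        have : (2:ℝ) • u = (m + u) - (m - u) := by module
        rw [this, h, sub_self]
      simpa using this) (by linarith) (by linarith)
    convert this using 1; module
  have c1 : ContinuousAt (fun p : E × E × ℝ => Real.log (φ (p.1 + p.2.1))) (m, u, t) :=
    ContinuousAt.comp (f := fun p : E × E × ℝ => p.1 + p.2.1) (g := fun z => Real.log (φ z))
      (B.v_contAt h) (by fun_prop)
  have c2 : ContinuousAt (fun p : E × E × ℝ => Real.log (φ (p.1 + p.2.2 • p.2.1))) (m, u, t) :=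
    ContinuousAt.comp (f := fun p : E × E × ℝ => p.1 + p.2.2 • p.2.1) (g := fun z => Real.log (φ z))
      (B.v_contAt hin) (by fun_prop)
  exact ⟨_, (c1.sub c2).tendsto.eventually (gt_mem_nhds (lt_add_one _))⟩

lemma br2 (B : BD Ω ρ φ) {m u : E} {t : ℝ} (h1 : m + u ∈ closure Ω) (h2 : m - u ∈ closure Ω)
    (hu : u ≠ 0) (ht0 : 0 ≤ t) (ht1 : t < 1) (h : m + u ∉ Ω) (M : ℝ) :
    ∀ᶠ p : E × E × ℝ in 𝓝 (m, u, t), p.1 + p.2.1 ∈ Ω →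
      Real.log (φ (p.1 + p.2.1)) - Real.log (φ (p.1 + p.2.2 • p.2.1)) < M := by
  have hin : m + t • u ∈ Ω := by
    have := B.between h1 h2 (x := m + u) (y := m - u) (t := (1 - t)/2) (by
      intro h; apply hu; have : (2:ℝ) • u = 0 := by
        have : (2:ℝ) • u = (m + u) - (m - u) := by module
        rw [this, h, sub_self]
      simpa using this) (by linarith) (by linarith)
    convert this using 1; module
  have c2 : ContinuousAt (fun p : E × E × ℝ => Real.log (φ (p.1 + p.2.2 • p.2.1))) (m, u, t) :=
    ContinuousAt.comp (f := fun p : E × E × ℝ => p.1 + p.2.2 • p.2.1) (g := fun z => Real.log (φ z))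
      (B.v_contAt hin) (by fun_prop)
  have hf := B.fr_of h1 h
  have c1 := (B.hφC.continuousOn _ h1).tendsto
  rw [B.hφbd _ hf] at c1
  set L := Real.log (φ (m + t • u)) with hL
  have ev1 := c1.eventually (gt_mem_nhds (Real.exp_pos (M + (L - 1))))
  rw [eventually_nhdsWithin_iff] at ev1
  have cc : ContinuousAt (fun p : E × E × ℝ => p.1 + p.2.1) (m, u, t) := by fun_prop
  have ev2 := cc.tendsto.eventually ev1
  have ev3 := c2.tendsto.eventually (lt_mem_nhds (sub_one_lt L))
  filter_upwards [ev2, ev3] with p hp2 hp3 hp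
  have hlt := hp2 (subset_closure hp)
  have := (Real.log_lt_iff_lt_exp (B.hφpos _ hp)).2 hlt
  linarith

lemma br3 (B : BD Ω ρ φ) {m u : E} (h1 : m + u ∈ closure Ω) (h2 : m - u ∈ closure Ω)
    (hu : u ≠ 0) {η : ℝ} (hη : 0 < η) :
    ∀ᶠ p : E × E × ℝ in 𝓝 (m, u, 1), p.1 + p.2.1 ∈ Ω → p.1 - p.2.1 ∈ Ω → p.2.2 ∈ Icc (0:ℝ) 1 →
      Real.log (φ (p.1 + p.2.1)) - Real.log (φ (p.1 + p.2.2 • p.2.1)) < η := by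
  by_cases h : m + u ∈ Ω
  · have c1 : ContinuousAt (fun p : E × E × ℝ => Real.log (φ (p.1 + p.2.1))) (m, u, 1) :=
      ContinuousAt.comp (f := fun p : E × E × ℝ => p.1 + p.2.1) (g := fun z => Real.log (φ z))
        (B.v_contAt h) (by fun_prop)
    have c2 : ContinuousAt (fun p : E × E × ℝ => Real.log (φ (p.1 + p.2.2 • p.2.1))) (m, u, 1) :=
      ContinuousAt.comp (f := fun p : E × E × ℝ => p.1 + p.2.2 • p.2.1) (g := fun z => Real.log (φ z))
        (B.v_contAt (by simpa using h)) (by fun_prop)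
    have c3 : ContinuousAt (fun p : E × E × ℝ =>
      Real.log (φ (p.1 + p.2.1)) - Real.log (φ (p.1 + p.2.2 • p.2.1))) (m, u, 1) := c1.sub c2
    have c3 := c3.tendsto
    simp only [one_smul, sub_self] at c3
    filter_upwards [c3.eventually (gt_mem_nhds hη)] with p hp _ _ _ using hp
  · have hf := B.fr_of h1 h
    have hne : m - u ≠ m + u := by
      intro h; apply hu; have : (2:ℝ) • u = 0 := by
        have : (2:ℝ) • u = (m + u) - (m - u) := by module
        rw [this, h, sub_self]
      simpa using this
    have hs := B.support hf h2 hne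
    have e : m - u - (m + u) = (2:ℝ) • (-u) := by module
    rw [e, inner_smul_right] at hs
    have hpos := B.dphi_pos hf (v := -u) (by linarith)
    -- derivative positivity near
    have c1 : Tendsto (fun w : E × E => fderivWithin ℝ φ (closure Ω) w.1 w.2)
      (𝓝[Prod.fst ⁻¹' (closure Ω)] (m + u, -u)) (𝓝 (fderivWithin ℝ φ (closure Ω) (m + u) (-u))) := by
      have hfst : Tendsto (Prod.fst : E × E → E) (𝓝[Prod.fst ⁻¹' (closure Ω)] (m + u, -u))
          (𝓝[closure Ω] (m + u)) := by
        refine tendsto_nhdsWithin_iff.2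
          ⟨(continuous_fst.tendsto (m + u,-u)).mono_left nhdsWithin_le_nhds, ?_⟩
        exact self_mem_nhdsWithin
      have hsnd : Tendsto (Prod.snd : E × E → E) (𝓝[Prod.fst ⁻¹' (closure Ω)] (m + u, -u)) (𝓝 (-u)) :=
        (continuous_snd.tendsto (m + u,-u)).mono_left nhdsWithin_le_nhds
      exact tendsto_clm_app ((B.phi_cont1 _ h1).tendsto.comp hfst) hsnd
    have ev := c1.eventually (lt_mem_nhds hpos)
    rw [eventually_nhdsWithin_iff, nhds_prod_eq] at ev
    obtain ⟨P, hP, Q, hQ, hPQ⟩ := eventually_prod_iff.1 ev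
    obtain ⟨r, hr, hPr⟩ := Metric.eventually_nhds_iff.1 hP
    have cc1 : ContinuousAt (fun p : E × E × ℝ => p.1 + p.2.1) (m, u, 1) := by fun_prop
    have cc2 : ContinuousAt (fun p : E × E × ℝ => p.1 + p.2.2 • p.2.1) (m, u, 1) := by fun_prop
    have cc3 : ContinuousAt (fun p : E × E × ℝ => -p.2.1) (m, u, 1) := by fun_prop
    have ev1 := cc1.tendsto.eventually (Metric.ball_mem_nhds _ hr)
    have ev2 := cc2.tendsto.eventually (Metric.ball_mem_nhds _ hr)
    have ev3 := cc3.tendsto.eventually hQ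
    filter_upwards [ev1, ev2, ev3] with p hp1 hp2 hp3 ha hb ht
    obtain ⟨m', u', t⟩ := p
    simp only [one_smul] at hp1 hp2 hp3 ha hb ht ⊢
    have hbb := B.seg_mem ha hb (t := t) ⟨by linarith [ht.1], ht.2⟩
    have hmem : ∀ s ∈ Icc t 1, m' + s • u' ∈ Ω := fun s hs =>
      B.seg_mem ha hb ⟨by linarith [ht.1, hs.1], hs.2⟩
    have hball : ∀ s ∈ Icc t 1, m' + s • u' ∈ Metric.ball (m + u) r := by
      intro s hs
      rcases eq_or_lt_of_le ht.2 with h1t | h1t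
      · have : s = 1 := by linarith [hs.1, hs.2]
        simpa [this] using hp1
      have := (convex_ball (m + u) r) hp1 hp2 (a := (s-t)/(1-t)) (b := (1-s)/(1-t))
        (div_nonneg (by linarith [hs.1]) (by linarith)) (div_nonneg (by linarith [hs.2]) (by linarith))
        (by have : 1 - t ≠ 0 := by linarith
            field_simp; ring)
      convert this using 1
      have h0 : 1 - t ≠ 0 := by linarith
      have e1 : (s-t)/(1-t) + (1-s)/(1-t) = 1 := by field_simp; ring
      have e2 : (s-t)/(1-t) + (1-s)/(1-t) * t = s := by field_simp; ring
      calc m' + s • u' = ((s-t)/(1-t) + (1-s)/(1-t)) • m' + ((s-t)/(1-t) + (1-s)/(1-t) * t) • u' := by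
            rw [e1, e2, one_smul]
        _ = _ := by module
    have hanti : AntitoneOn (fun s : ℝ => Real.log (φ (m' + s • u'))) (Icc t 1) := by
      apply antitoneOn_of_deriv_nonpos (convex_Icc _ _)
      · intro s hs
        exact (B.line1 (hmem s hs)).continuousAt.continuousWithinAt
      · intro s hs
        exact (B.line1 (hmem s (interior_subset hs))).differentiableAt.differentiableWithinAt
      · intro s hs
        have hs := interior_subset hs
        rw [(B.line1 (hmem s hs)).deriv]
        have := hPQ (hPr (hball s hs)) hp3 (subset_closure (hmem s hs))
        simp only [B.fdw_eq (hmem s hs), map_neg] at this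
        exact div_nonpos_of_nonpos_of_nonneg (by linarith) (B.hφpos _ (hmem s hs)).le
    have := hanti (left_mem_Icc.2 ht.2) (right_mem_Icc.2 ht.2) ht.2
    simp only [one_smul] at this
    linarith

end BD

/-- The four point function. -/
noncomputable def ZZ {E : Type*} [NormedAddCommGroup E] [NormedSpace ℝ E] (φ : E → ℝ) (w : ℝ → ℝ)
    (p : E × E × ℝ) : ℝ :=
  (Real.log (φ (p.1 + p.2.1)) - Real.log (φ (p.1 + p.2.2 • p.2.1))) +
  (Real.log (φ (p.1 - p.2.1)) - Real.log (φ (p.1 - p.2.2 • p.2.1)))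
  + (2 * w (p.2.2 * ‖p.2.1‖) - 2 * w ‖p.2.1‖)

/-- Properties of the one-dimensional comparison function. -/
structure WD (w w1 w2 : ℝ → ℝ) (R : ℝ) : Prop where
  h1 : ∀ s, |s| < R → HasDerivAt w (w1 s) s
  h2 : ∀ s, |s| < R → HasDerivAt w1 (w2 s) s
  even : ∀ s, w (-s) = w s
  dec : ∀ a b, 0 ≤ b → b < a → a < R → w2 a + w1 a ^ 2 < w2 b + w1 b ^ 2

namespace BD

variable {E : Type*} [NormedAddCommGroup E] [InnerProductSpace ℝ E] [FiniteDimensional ℝ E]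
    {Ω : Set E} {ρ φ : E → ℝ} {w w1 w2 : ℝ → ℝ} {R : ℝ}

lemma u_lt {m u : E} (h1 : m + u ∈ closure Ω) (h2 : m - u ∈ closure Ω)
    (hR : ∀ x ∈ closure Ω, ∀ y ∈ closure Ω, ‖x - y‖ < 2 * R) : ‖u‖ < R := by
  have := hR _ h1 _ h2
  have e : m + u - (m - u) = (2:ℝ) • u := by module
  rw [e, norm_smul] at this
  norm_num at this
  linarith

lemma w_cont (hw : WD w w1 w2 R) {m u : E} {t : ℝ} (hu : ‖u‖ < R) (ht0 : 0 ≤ t) (ht1 : t ≤ 1) :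
    ContinuousAt (fun p : E × E × ℝ => 2 * w (p.2.2 * ‖p.2.1‖) - 2 * w ‖p.2.1‖) (m, u, t) := by
  have hb : |t * ‖u‖| < R := by
    rw [abs_of_nonneg (by positivity)]; nlinarith [norm_nonneg u]
  have c1 : ContinuousAt (fun p : E × E × ℝ => w (p.2.2 * ‖p.2.1‖)) (m, u, t) :=
    ContinuousAt.comp (f := fun p : E × E × ℝ => p.2.2 * ‖p.2.1‖) (g := w)
      (hw.h1 _ hb).continuousAt (by fun_prop)
  have c2 : ContinuousAt (fun p : E × E × ℝ => w (‖p.2.1‖)) (m, u, t) :=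
    ContinuousAt.comp (f := fun p : E × E × ℝ => ‖p.2.1‖) (g := w)
      (hw.h1 _ (by rwa [abs_of_nonneg (norm_nonneg _)])).continuousAt (by fun_prop)
  exact (c1.const_mul 2).sub (c2.const_mul 2)

lemma bdry_lt (B : BD Ω ρ φ) (hw : WD w w1 w2 R)
    (hR : ∀ x ∈ closure Ω, ∀ y ∈ closure Ω, ‖x - y‖ < 2 * R)
    {m u : E} {t : ℝ} (h1 : m + u ∈ closure Ω) (h2 : m - u ∈ closure Ω) (ht : t ∈ Icc (0:ℝ) 1)
    (hb : ¬ (m + u ∈ Ω ∧ m - u ∈ Ω)) {δ : ℝ} (hδ : 0 < δ) :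
    ∀ᶠ p : E × E × ℝ in 𝓝 (m, u, t), p.1 + p.2.1 ∈ Ω → p.1 - p.2.1 ∈ Ω → p.2.2 ∈ Icc (0:ℝ) 1 →
      ZZ φ w p < δ := by
  have huR := u_lt h1 h2 hR
  have hwc := (w_cont hw (m := m) huR ht.1 ht.2).tendsto
  have hneg : Tendsto (fun p : E × E × ℝ => ((p.1, -p.2.1, p.2.2) : E × E × ℝ)) (𝓝 (m, u, t))
      (𝓝 (m, -u, t)) := by
    have : Continuous (fun p : E × E × ℝ => ((p.1, -p.2.1, p.2.2) : E × E × ℝ)) := by fun_prop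
    exact this.tendsto (m, u, t)
  have h1' : m + -u ∈ closure Ω := by simpa [sub_eq_add_neg] using h2
  have h2' : m - -u ∈ closure Ω := by simpa using h1
  rcases eq_or_ne u 0 with hu | hu
  · subst hu
    have hm : m ∈ frontier Ω := by
      apply B.fr_of (by simpa using h1)
      simpa using hb
    obtain ⟨r, hr, H⟩ := B.near_conc hm
    have cc1 : ContinuousAt (fun p : E × E × ℝ => p.1 + p.2.1) (m, 0, t) := by fun_prop
    have cc2 : ContinuousAt (fun p : E × E × ℝ => p.1 - p.2.1) (m, 0, t) := by fun_prop
    have ev1 := cc1.tendsto.eventually (Metric.ball_mem_nhds _ hr)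
    have ev2 := cc2.tendsto.eventually (Metric.ball_mem_nhds _ hr)
    simp only [norm_zero, mul_zero, sub_self] at hwc
    filter_upwards [ev1, ev2, hwc.eventually (gt_mem_nhds hδ)] with p hp1 hp2 hp3 ha hb ht'
    simp only [add_zero, sub_zero] at hp1 hp2
    have := H p.1 p.2.1 ha hb hp1 hp2 _ ht'
    unfold ZZ
    linarith
  rcases eq_or_lt_of_le ht.2 with ht1 | ht1
  · subst ht1
    have b1 := B.br3 h1 h2 hu (η := δ/4) (by positivity)
    have b2 := hneg.eventually (B.br3 h1' h2' (neg_ne_zero.2 hu) (η := δ/4) (by positivity))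
    simp only [one_mul, sub_self] at hwc
    filter_upwards [b1, b2, hwc.eventually (gt_mem_nhds (half_pos hδ))] with p hp1 hp2 hp3 ha hb ht'
    have q1 := hp1 ha hb ht'
    have q2 := hp2 (by simpa [sub_eq_add_neg] using hb) (by simpa using ha) ht'
    simp only [smul_neg, ← sub_eq_add_neg] at q2
    unfold ZZ
    linarith
  · have ev3 := hwc.eventually (gt_mem_nhds (lt_add_one _))
    by_cases c1 : m + u ∈ Ω
    · have c2 : m + -u ∉ Ω := fun h => hb ⟨c1, by simpa [sub_eq_add_neg] using h⟩
      obtain ⟨M, b1⟩ := B.br1 h1 h2 hu ht.1 ht1 c1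
      have b2 := hneg.eventually (B.br2 h1' h2' (neg_ne_zero.2 hu) ht.1 ht1 c2
        (δ - M - (2 * w (t * ‖u‖) - 2 * w ‖u‖ + 1)))
      filter_upwards [b1, b2, ev3] with p hp1 hp2 hp3 ha hb ht'
      have q2 := hp2 (by simpa [sub_eq_add_neg] using hb)
      simp only [smul_neg, ← sub_eq_add_neg] at q2
      unfold ZZ
      linarith
    · have : ∃ M : ℝ, ∀ᶠ p : E × E × ℝ in 𝓝 (m, -u, t), p.1 + p.2.1 ∈ Ω →
          Real.log (φ (p.1 + p.2.1)) - Real.log (φ (p.1 + p.2.2 • p.2.1)) < M := by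
        by_cases c2 : m + -u ∈ Ω
        · obtain ⟨M, hM⟩ := B.br1 h1' h2' (neg_ne_zero.2 hu) ht.1 ht1 c2
          exact ⟨M, hM.mono fun p hp _ => hp⟩
        · exact ⟨0, B.br2 h1' h2' (neg_ne_zero.2 hu) ht.1 ht1 c2 0⟩
      obtain ⟨M, b2⟩ := this
      have b2 := hneg.eventually b2
      have b1 := B.br2 h1 h2 hu ht.1 ht1 c1 (δ - M - (2 * w (t * ‖u‖) - 2 * w ‖u‖ + 1))
      filter_upwards [b1, b2, ev3] with p hp1 hp2 hp3 ha hb ht'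
      have q1 := hp1 ha
      have q2 := hp2 (by simpa [sub_eq_add_neg] using hb)
      simp only [smul_neg, ← sub_eq_add_neg] at q2
      unfold ZZ
      linarith

lemma ZZ_cont (B : BD Ω ρ φ) (hw : WD w w1 w2 R)
    (hR : ∀ x ∈ closure Ω, ∀ y ∈ closure Ω, ‖x - y‖ < 2 * R)
    {p : E × E × ℝ} (h1 : p.1 + p.2.1 ∈ Ω) (h2 : p.1 - p.2.1 ∈ Ω) (ht : p.2.2 ∈ Icc (0:ℝ) 1) :
    ContinuousAt (ZZ φ w) p := by
  have hwc := w_cont hw (m := p.1) (u_lt (subset_closure h1) (subset_closure h2) hR) ht.1 ht.2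
  have ht' : p.2.2 ∈ Icc (-1:ℝ) 1 := ⟨by linarith [ht.1], ht.2⟩
  have c1 : ContinuousAt (fun p : E × E × ℝ => Real.log (φ (p.1 + p.2.1))) p :=
    ContinuousAt.comp (f := fun p : E × E × ℝ => p.1 + p.2.1) (g := fun z => Real.log (φ z))
      (B.v_contAt h1) (by fun_prop)
  have c2 : ContinuousAt (fun p : E × E × ℝ => Real.log (φ (p.1 + p.2.2 • p.2.1))) p :=
    ContinuousAt.comp (f := fun p : E × E × ℝ => p.1 + p.2.2 • p.2.1) (g := fun z => Real.log (φ z))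
      (B.v_contAt (B.seg_mem h1 h2 ht')) (by fun_prop)
  have c3 : ContinuousAt (fun p : E × E × ℝ => Real.log (φ (p.1 - p.2.1))) p :=
    ContinuousAt.comp (f := fun p : E × E × ℝ => p.1 - p.2.1) (g := fun z => Real.log (φ z))
      (B.v_contAt h2) (by fun_prop)
  have c4 : ContinuousAt (fun p : E × E × ℝ => Real.log (φ (p.1 - p.2.2 • p.2.1))) p :=
    ContinuousAt.comp (f := fun p : E × E × ℝ => p.1 - p.2.2 • p.2.1) (g := fun z => Real.log (φ z))
      (B.v_contAt (B.seg_mem' h1 h2 ht')) (by fun_prop)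
  exact ((c1.sub c2).add (c3.sub c4)).add hwc

lemma exists_max (B : BD Ω ρ φ) (hw : WD w w1 w2 R)
    (hR : ∀ x ∈ closure Ω, ∀ y ∈ closure Ω, ‖x - y‖ < 2 * R)
    {p0 : E × E × ℝ} (h1 : p0.1 + p0.2.1 ∈ Ω) (h2 : p0.1 - p0.2.1 ∈ Ω) (ht : p0.2.2 ∈ Icc (0:ℝ) 1)
    (hpos : 0 < ZZ φ w p0) :
    ∃ p : E × E × ℝ, p.1 + p.2.1 ∈ Ω ∧ p.1 - p.2.1 ∈ Ω ∧ p.2.2 ∈ Icc (0:ℝ) 1 ∧ 0 < ZZ φ w p ∧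
      ∀ p' : E × E × ℝ, p'.1 + p'.2.1 ∈ Ω → p'.1 - p'.2.1 ∈ Ω → p'.2.2 ∈ Icc (0:ℝ) 1 →
        ZZ φ w p' ≤ ZZ φ w p := by
  set δ := ZZ φ w p0 with hδ
  set P : Set (E × E × ℝ) :=
    {p | p.1 + p.2.1 ∈ closure Ω ∧ p.1 - p.2.1 ∈ closure Ω ∧ p.2.2 ∈ Icc (0:ℝ) 1} with hP
  set K : Set (E × E × ℝ) :=
    {p | p.1 + p.2.1 ∈ Ω ∧ p.1 - p.2.1 ∈ Ω ∧ p.2.2 ∈ Icc (0:ℝ) 1 ∧ δ ≤ ZZ φ w p} with hK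
  have hCc : IsCompact (closure Ω) := B.hbd.isCompact_closure
  have hPc : IsCompact P := by
    have hc : IsCompact ((closure Ω) ×ˢ ((closure Ω) ×ˢ (Icc (0:ℝ) 1))) :=
      hCc.prod (hCc.prod isCompact_Icc)
    have him := hc.image (f := fun q : E × E × ℝ =>
      (((1/2:ℝ) • (q.1 + q.2.1), (1/2:ℝ) • (q.1 - q.2.1), q.2.2) : E × E × ℝ)) (by fun_prop)
    convert him using 1
    ext p
    constructor
    · rintro ⟨a, b, c⟩
      refine ⟨(p.1 + p.2.1, p.1 - p.2.1, p.2.2), ⟨a, b, c⟩, ?_⟩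
      ext1
      · simp only; module
      · ext1
        · simp only; module
        · rfl
    · rintro ⟨q, ⟨a, b, c⟩, rfl⟩
      refine ⟨?_, ?_, c⟩
      · convert a using 1; simp only; module
      · convert b using 1; simp only; module
  have hKP : K ⊆ P := fun p hp => ⟨subset_closure hp.1, subset_closure hp.2.1, hp.2.2.1⟩
  have hKcl : IsClosed K := by
    apply isClosed_of_closure_subset
    intro p hp
    have hpP : p ∈ P := (closure_minimal hKP hPc.isClosed) hp
    have hfreq := mem_closure_iff_frequently.1 hp
    by_cases hG : p.1 + p.2.1 ∈ Ω ∧ p.1 - p.2.1 ∈ Ω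
    · refine ⟨hG.1, hG.2, hpP.2.2, ?_⟩
      by_contra hcon
      push Not at hcon
      have := (B.ZZ_cont hw hR hG.1 hG.2 hpP.2.2).tendsto.eventually (gt_mem_nhds hcon)
      obtain ⟨p', hp', hlt⟩ := (hfreq.and_eventually this).exists
      linarith [hp'.2.2.2]
    · exfalso
      have := B.bdry_lt hw hR (m := p.1) (u := p.2.1) (t := p.2.2) hpP.1 hpP.2.1 hpP.2.2 hG hpos
      obtain ⟨p', hp', hlt⟩ := (hfreq.and_eventually this).exists
      have := hlt hp'.1 hp'.2.1 hp'.2.2.1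
      linarith [hp'.2.2.2]
  have hKc : IsCompact K := hPc.of_isClosed_subset hKcl hKP
  obtain ⟨p, hpK, hmax⟩ := hKc.exists_isMaxOn ⟨p0, h1, h2, ht, le_rfl⟩
    (f := ZZ φ w) (fun p hp => (B.ZZ_cont hw hR hp.1 hp.2.1 hp.2.2.1).continuousWithinAt)
  refine ⟨p, hpK.1, hpK.2.1, hpK.2.2.1, by linarith [hpK.2.2.2], fun p' a b c => ?_⟩
  by_cases hd : δ ≤ ZZ φ w p'
  · exact hmax ⟨a, b, c, hd⟩
  · push Not at hd; linarith [hpK.2.2.2]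

end BD

lemma second_test {f f' : ℝ → ℝ} {c : ℝ} (hmax : IsLocalMax f 0)
    (h1 : ∀ᶠ s in 𝓝 (0:ℝ), HasDerivAt f (f' s) s) (h2 : HasDerivAt f' c 0) : c ≤ 0 := by
  by_contra hc
  push Not at hc
  have hd : deriv f =ᶠ[𝓝 0] f' := h1.mono fun s hs => hs.deriv
  have hdd : deriv (deriv f) 0 = c := by rw [hd.deriv_eq]; exact h2.deriv
  have hmin := isLocalMin_of_deriv_deriv_pos (f := f) (x₀ := 0) (by rw [hdd]; exact hc)
    hmax.deriv_eq_zero h1.self_of_nhds.continuousAt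
  have hconst : f =ᶠ[𝓝 0] fun _ => f 0 := by
    filter_upwards [hmax, hmin] with s a b using le_antisymm a b
  have h3 : deriv f =ᶠ[𝓝 0] fun _ => 0 := by
    have := hconst.deriv
    simpa using this
  have : deriv (deriv f) 0 = 0 := by rw [h3.deriv_eq]; simp
  linarith

lemma vec_ineq {E : Type*} [NormedAddCommGroup E] [InnerProductSpace ℝ E] {e α β : E} {a b t : ℝ}
    (he : ‖e‖ = 1) (hα : ⟪α, e⟫ = a) (hβ : ⟪β, e⟫ = b)
    (h : ∀ ξ : E, ⟪e, ξ⟫ = 0 → ⟪α, ξ⟫ = t * ⟪β, ξ⟫) (ht0 : 0 ≤ t) (ht1 : t ≤ 1) :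
    ‖α‖^2 - ‖β‖^2 ≤ a^2 - b^2 := by
  set ξ := (α - a • e) - t • (β - b • e) with hξ
  have hee : ⟪e, e⟫ = 1 := by rw [real_inner_self_eq_norm_sq, he]; norm_num
  have hα' : ⟪e, α⟫ = a := by rw [real_inner_comm]; exact hα
  have hβ' : ⟪e, β⟫ = b := by rw [real_inner_comm]; exact hβ
  have h0 : ⟪e, ξ⟫ = 0 := by
    rw [hξ]; simp only [inner_sub_right, inner_smul_right, hee, hα', hβ']; ring
  have h1 : ⟪ξ, ξ⟫ = 0 := by
    nth_rw 1 [hξ]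
    simp only [inner_sub_left, inner_smul_left, h0, h ξ h0]
    simp
  have h2 : ξ = 0 := inner_self_eq_zero.1 h1
  set γ := β - b • e with hγ
  have h3 : α = a • e + t • γ := by
    have : α = ξ + (a • e + t • γ) := by rw [hξ]; module
    rw [this, h2, zero_add]
  have h4 : β = b • e + γ := by rw [hγ]; module
  have h5 : ⟪e, γ⟫ = 0 := by
    rw [hγ]; simp only [inner_sub_right, inner_smul_right, hee, hβ']; ring
  have n1 : ‖α‖^2 = a^2 + t^2 * ‖γ‖^2 := by
    rw [h3, norm_add_sq_real, inner_smul_left, inner_smul_right, h5, norm_smul, norm_smul, he]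
    simp [mul_pow]
  have n2 : ‖β‖^2 = b^2 + ‖γ‖^2 := by
    rw [h4, norm_add_sq_real, inner_smul_left, h5, norm_smul, he]
    simp
  rw [n1, n2]
  have : t^2 ≤ 1 := by nlinarith
  nlinarith [sq_nonneg ‖γ‖]

namespace BD

variable {E : Type*} [NormedAddCommGroup E] [InnerProductSpace ℝ E] [FiniteDimensional ℝ E]
    {Ω : Set E} {ρ φ : E → ℝ} {w w1 w2 : ℝ → ℝ} {R : ℝ}

lemma ev_mem (B : BD Ω ρ φ) {x : E} (hx : x ∈ Ω) (ξ : E) : ∀ᶠ s in 𝓝 (0:ℝ), x + s • ξ ∈ Ω := by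
  have : ContinuousAt (fun s : ℝ => x + s • ξ) 0 := by fun_prop
  exact this.tendsto.eventually (B.hΩ.mem_nhds (by simpa using hx))

lemma four1 (B : BD Ω ρ φ) {x y x' y' : E} (hx : x ∈ Ω) (hy : y ∈ Ω) (hx' : x' ∈ Ω) (hy' : y' ∈ Ω)
    (ξ η ξ' η' : E) {k : ℝ → ℝ} {k1 : ℝ} (hk : HasDerivAt k k1 0)
    (hmax : IsLocalMax (fun s : ℝ => (Real.log (φ (x + s • ξ)) - Real.log (φ (x' + s • ξ')))
      + (Real.log (φ (y + s • η)) - Real.log (φ (y' + s • η'))) + k s) 0) :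
    (fderiv ℝ φ x ξ / φ x - fderiv ℝ φ x' ξ' / φ x') +
    (fderiv ℝ φ y η / φ y - fderiv ℝ φ y' η' / φ y') + k1 = 0 := by
  have l1 := B.line1 (z := x) (ξ := ξ) (s := 0) (by simpa using hx)
  have l2 := B.line1 (z := x') (ξ := ξ') (s := 0) (by simpa using hx')
  have l3 := B.line1 (z := y) (ξ := η) (s := 0) (by simpa using hy)
  have l4 := B.line1 (z := y') (ξ := η') (s := 0) (by simpa using hy')
  have := hmax.hasDerivAt_eq_zero (((l1.sub l2).add (l3.sub l4)).add hk)
  simpa using this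

lemma four2 (B : BD Ω ρ φ) {x y x' y' : E} (hx : x ∈ Ω) (hy : y ∈ Ω) (hx' : x' ∈ Ω) (hy' : y' ∈ Ω)
    (ξ η ξ' η' : E) {k k1 : ℝ → ℝ} {k2 : ℝ} (hk : ∀ᶠ s in 𝓝 (0:ℝ), HasDerivAt k (k1 s) s)
    (hk1 : HasDerivAt k1 k2 0)
    (hmax : IsLocalMax (fun s : ℝ => (Real.log (φ (x + s • ξ)) - Real.log (φ (x' + s • ξ')))
      + (Real.log (φ (y + s • η)) - Real.log (φ (y' + s • η'))) + k s) 0) :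
    ((fderiv ℝ (fderiv ℝ φ) x ξ ξ / φ x - (fderiv ℝ φ x ξ / φ x)^2)
      - (fderiv ℝ (fderiv ℝ φ) x' ξ' ξ' / φ x' - (fderiv ℝ φ x' ξ' / φ x')^2)) +
    ((fderiv ℝ (fderiv ℝ φ) y η η / φ y - (fderiv ℝ φ y η / φ y)^2)
      - (fderiv ℝ (fderiv ℝ φ) y' η' η' / φ y' - (fderiv ℝ φ y' η' / φ y')^2)) + k2 ≤ 0 := by
  have l1 := B.line2 (z := x) (ξ := ξ) (s := 0) (by simpa using hx)
  have l2 := B.line2 (z := x') (ξ := ξ') (s := 0) (by simpa using hx')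
  have l3 := B.line2 (z := y) (ξ := η) (s := 0) (by simpa using hy)
  have l4 := B.line2 (z := y') (ξ := η') (s := 0) (by simpa using hy')
  have hd := ((l1.sub l2).add (l3.sub l4)).add hk1
  have := second_test hmax (by
    filter_upwards [hk, B.ev_mem hx ξ, B.ev_mem hx' ξ', B.ev_mem hy η, B.ev_mem hy' η']
      with s h0 h1 h2 h3 h4
    exact (((B.line1 h1).sub (B.line1 h2)).add ((B.line1 h3).sub (B.line1 h4))).add h0) hd
  simpa using this

set_option maxHeartbeats 2000000 in
lemma no_max (B : BD Ω ρ φ) (hw : WD w w1 w2 R)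
    (hR : ∀ x ∈ closure Ω, ∀ y ∈ closure Ω, ‖x - y‖ < 2 * R)
    {q : E → ℝ} {lam : ℝ} (hq : ConvexOn ℝ (closure Ω) q)
    (heig : ∀ x ∈ Ω, ∀ (S : Finset E) (b : OrthonormalBasis S ℝ E),
      ∑ i, fderiv ℝ (fderiv ℝ φ) x (b i) (b i) - q x * φ x = - lam * φ x)
    {m u : E} {t : ℝ} (hx : m + u ∈ Ω) (hy : m - u ∈ Ω) (ht0 : 0 ≤ t) (ht1 : t < 1) (hu : u ≠ 0)
    (hmax : ∀ m' u' : E, ∀ t' : ℝ, m' + u' ∈ Ω → m' - u' ∈ Ω → t' ∈ Icc (-1:ℝ) 1 →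
        ZZ φ w (m', u', t') ≤ ZZ φ w (m, u, t)) : False := by
  classical
  have htI : t ∈ Icc (-1:ℝ) 1 := ⟨by linarith, ht1.le⟩
  have hx' := B.seg_mem hx hy htI
  have hy' := B.seg_mem' hx hy htI
  have huR : ‖u‖ < R := u_lt (subset_closure hx) (subset_closure hy) hR
  set a := ‖u‖ with ha
  have ha0 : 0 < a := norm_pos_iff.2 hu
  have hba : t * a < a := by nlinarith
  have hb0 : 0 ≤ t * a := by positivity
  have haR : |a| < R := by rwa [abs_of_pos ha0]
  have hbR : |t * a| < R := by rw [abs_of_nonneg hb0]; linarith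
  -- translations
  have T : ∀ ξ : E, IsLocalMax (fun s : ℝ =>
      (Real.log (φ (m + u + s • ξ)) - Real.log (φ (m + t • u + s • ξ)))
      + (Real.log (φ (m - u + s • ξ)) - Real.log (φ (m - t • u + s • ξ)))
      + (fun _ => 2 * w (t * a) - 2 * w a) s) 0 := by
    intro ξ
    filter_upwards [B.ev_mem hx ξ, B.ev_mem hy ξ] with s h1 h2
    have := hmax (m + s • ξ) u t (by convert h1 using 1; module) (by convert h2 using 1; module) htI
    unfold ZZ at this
    simp only [zero_smul, add_zero]
    convert this using 6 <;> first | rfl | module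
  have T1 := fun ξ => B.four1 hx hy hx' hy' ξ ξ ξ ξ (hasDerivAt_const 0 _) (T ξ)
  have T2 := fun ξ => B.four2 hx hy hx' hy' ξ ξ ξ ξ (k1 := fun _ => 0)
    (Eventually.of_forall fun s => hasDerivAt_const s _) (hasDerivAt_const 0 _) (T ξ)
  -- stretching
  set e := a⁻¹ • u with he
  have hue : u = a • e := by rw [he, smul_smul, mul_inv_cancel₀ ha0.ne', one_smul]
  have hen : ‖e‖ = 1 := by rw [he, norm_smul, norm_inv, norm_norm, ← ha]; field_simp
  have S : IsLocalMax (fun s : ℝ =>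
      (Real.log (φ (m + u + s • e)) - Real.log (φ (m + t • u + s • e)))
      + (Real.log (φ (m - u + s • (-e))) - Real.log (φ (m - t • u + s • (-e))))
      + (fun s => 2 * w (t * a + s) - 2 * w (a + s)) s) 0 := by
    have e1 : ∀ᶠ s in 𝓝 (0:ℝ), -(a/2) < s := lt_mem_nhds (by linarith)
    filter_upwards [B.ev_mem hx e, B.ev_mem hy (-e), e1] with s h1 h2 h3
    have has : 0 < a + s := by linarith
    have hn : ‖(a + s) • e‖ = a + s := by
      rw [norm_smul, hen, Real.norm_eq_abs, abs_of_pos has, mul_one]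
    have hm := hmax m ((a + s) • e) ((t * a + s) / (a + s))
      (by convert h1 using 1; rw [hue]; module) (by convert h2 using 1; rw [hue]; module)
      ⟨by rw [le_div_iff₀ has]; linarith, by rw [div_le_one has]; linarith⟩
    unfold ZZ at hm
    simp only [smul_smul, hn, div_mul_cancel₀ _ has.ne'] at hm
    simp only [zero_smul, add_zero]
    convert hm using 6 <;> first | rfl | (rw [hue]; module)
  have kd : ∀ᶠ s in 𝓝 (0:ℝ), HasDerivAt (fun s => 2 * w (t * a + s) - 2 * w (a + s))
      (2 * w1 (t * a + s) - 2 * w1 (a + s)) s := by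
    have c1 : ContinuousAt (fun s : ℝ => |t * a + s|) 0 := by fun_prop
    have c2 : ContinuousAt (fun s : ℝ => |a + s|) 0 := by fun_prop
    filter_upwards [c1.tendsto.eventually (gt_mem_nhds (by simpa using hbR)),
      c2.tendsto.eventually (gt_mem_nhds (by simpa using haR))] with s h1 h2
    exact (((hw.h1 _ h1).comp_const_add (t * a) s).const_mul 2).sub
      (((hw.h1 _ h2).comp_const_add a s).const_mul 2)
  have kd2 : HasDerivAt (fun s => 2 * w1 (t * a + s) - 2 * w1 (a + s))
      (2 * w2 (t * a) - 2 * w2 a) 0 := by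
    have i1 := (hw.h2 (t * a + 0) (by simpa using hbR)).comp_const_add (t * a) 0
    have i2 := (hw.h2 (a + 0) (by simpa using haR)).comp_const_add a 0
    exact ((i1.const_mul 2).sub (i2.const_mul 2)).congr_deriv (by simp)
  have S1 := B.four1 hx hy hx' hy' _ _ _ _ kd.self_of_nhds S
  have S2 := B.four2 hx hy hx' hy' _ _ _ _ kd kd2 S
  simp only [add_zero] at S1
  -- inner variation
  have I : IsLocalMax (fun s : ℝ =>
      (Real.log (φ (m + u + s • (0:E))) - Real.log (φ (m + t • u + s • u)))
      + (Real.log (φ (m - u + s • (0:E))) - Real.log (φ (m - t • u + s • (-u))))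
      + (fun s => 2 * w (t * a + s * a) - 2 * w a) s) 0 := by
    rcases eq_or_lt_of_le ht0 with h0 | h0
    · have e1 : ∀ᶠ s in 𝓝 (0:ℝ), s ∈ Ioo (-1:ℝ) 1 := Ioo_mem_nhds (by norm_num) (by norm_num)
      filter_upwards [e1] with s h1
      have hm := hmax m u (t + s) hx hy ⟨by linarith [h1.1], by linarith [h1.2]⟩
      unfold ZZ at hm
      simp only [zero_smul, add_zero, smul_zero, zero_mul]
      convert hm using 6 <;> first | rfl | module | ring
    · have e1 : ∀ᶠ s in 𝓝 (0:ℝ), s ∈ Ioo (-t) (1-t) := Ioo_mem_nhds (by linarith) (by linarith)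
      filter_upwards [e1] with s h1
      have hm := hmax m u (t + s) hx hy ⟨by linarith [h1.1], by linarith [h1.2]⟩
      unfold ZZ at hm
      simp only [zero_smul, add_zero, smul_zero, zero_mul]
      convert hm using 6 <;> first | rfl | module | ring
  have kI : HasDerivAt (fun s => 2 * w (t * a + s * a) - 2 * w a) (2 * (w1 (t * a) * a)) 0 := by
    have i1 : HasDerivAt (fun s : ℝ => t * a + s * a) a 0 := by
      simpa using ((hasDerivAt_id (0:ℝ)).mul_const a).const_add (t * a)
    have i2 : HasDerivAt w (w1 (t * a)) (t * a + 0 * a) := by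
      simpa using hw.h1 _ hbR
    exact ((HasDerivAt.comp (0:ℝ) i2 i1).const_mul 2).sub_const _
  have I1 := B.four1 hx hy hx' hy' _ _ _ _ kI I
  -- rotation
  have Rt : ∀ ξ : E, ⟪u, ξ⟫ = 0 → IsLocalMax (fun s : ℝ =>
      (Real.log (φ (m + u + s • ξ)) - Real.log (φ (m + t • u + s • (t • ξ))))
      + (Real.log (φ (m - u + s • (-ξ))) - Real.log (φ (m - t • u + s • (-(t • ξ)))))
      + (fun s => 2 * w (t * Real.sqrt (a^2 + s^2 * ‖ξ‖^2)) -
          2 * w (Real.sqrt (a^2 + s^2 * ‖ξ‖^2))) s) 0 := by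
    intro ξ hξ
    filter_upwards [B.ev_mem hx ξ, B.ev_mem hy (-ξ)] with s h1 h2
    have hn : ‖u + s • ξ‖ = Real.sqrt (a^2 + s^2 * ‖ξ‖^2) := by
      rw [← Real.sqrt_sq (norm_nonneg (u + s • ξ)), norm_add_sq_real, inner_smul_right, hξ,
        norm_smul, mul_pow, Real.norm_eq_abs, sq_abs]
      simp [ha]
    have hn0 : Real.sqrt (a^2 + 0^2 * ‖ξ‖^2) = a := by
      simp [Real.sqrt_sq ha0.le]
    have hm := hmax m (u + s • ξ) t
      (by convert h1 using 1; module) (by convert h2 using 1; module) htI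
    unfold ZZ at hm
    simp only [hn] at hm
    simp only [zero_smul, add_zero, hn0]
    convert hm using 6 <;> first | rfl | module
  have kR : ∀ ξ : E, HasDerivAt (fun s => 2 * w (t * Real.sqrt (a^2 + s^2 * ‖ξ‖^2)) -
          2 * w (Real.sqrt (a^2 + s^2 * ‖ξ‖^2))) 0 0 := by
    intro ξ
    have hn0 : Real.sqrt (a^2 + 0^2 * ‖ξ‖^2) = a := by
      simp [Real.sqrt_sq ha0.le]
    have i1 : HasDerivAt (fun s : ℝ => Real.sqrt (a^2 + s^2 * ‖ξ‖^2)) 0 0 := by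
      have := (((hasDerivAt_pow 2 (0:ℝ)).mul_const (‖ξ‖^2)).const_add (a^2)).sqrt
        (by simp [ha0.ne'])
      simpa using this
    have i2 : HasDerivAt (fun s : ℝ => t * Real.sqrt (a^2 + s^2 * ‖ξ‖^2)) 0 0 := by
      simpa using i1.const_mul t
    have j1 : HasDerivAt w (w1 a) (Real.sqrt (a^2 + 0^2 * ‖ξ‖^2)) := by
      rw [hn0]; exact hw.h1 _ haR
    have j2 : HasDerivAt w (w1 (t * a)) (t * Real.sqrt (a^2 + 0^2 * ‖ξ‖^2)) := by
      rw [hn0]; exact hw.h1 _ hbR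
    have := ((HasDerivAt.comp (0:ℝ) j2 i2).const_mul 2).sub ((HasDerivAt.comp (0:ℝ) j1 i1).const_mul 2)
    exact this.congr_deriv (by simp)
  have R1 := fun ξ hξ => B.four1 hx hy hx' hy' _ _ _ _ (kR ξ) (Rt ξ hξ)
  -- vectors
  set x := m + u with hxd
  set y := m - u with hyd
  set x' := m + t • u with hxd'
  set y' := m - t • u with hyd'
  have Lg : ∀ z ξ : E, fderiv ℝ φ z ξ / φ z = ⟪(φ z)⁻¹ • gradient φ z, ξ⟫ := by
    intro z ξ
    rw [inner_smul_left]
    simp [gradient]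
    ring
  simp only [Lg] at T1 T2 S1 S2 I1 R1
  set px := (φ x)⁻¹ • gradient φ x
  set py := (φ y)⁻¹ • gradient φ y
  set gx := (φ x')⁻¹ • gradient φ x'
  set gy := (φ y')⁻¹ • gradient φ y'
  have hsum : px + py = gx + gy := by
    refine ext_inner_right ℝ fun ξ => ?_
    have := T1 ξ
    simp only [inner_add_left]
    linarith
  have hI : ⟪gx - gy, e⟫ = 2 * w1 (t * a) := by
    rw [he, inner_smul_right, inner_sub_left]
    simp only [inner_neg_right, inner_zero_right] at I1
    have h : ⟪gx, u⟫ - ⟪gy, u⟫ = a * (2 * w1 (t * a)) := by linarith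
    rw [h, inv_mul_cancel_left₀ ha0.ne']
  have hS : ⟪px - py, e⟫ = 2 * w1 a := by
    rw [inner_sub_left] at hI ⊢
    simp only [inner_neg_right] at S1
    linarith
  have hRt : ∀ ξ : E, ⟪e, ξ⟫ = 0 → ⟪px - py, ξ⟫ = t * ⟪gx - gy, ξ⟫ := by
    intro ξ hξ
    have := R1 ξ (by rw [hue, inner_smul_left, hξ]; simp)
    simp only [inner_neg_right, inner_smul_right] at this
    rw [inner_sub_left, inner_sub_left]
    linarith
  have hvec := vec_ineq hen hS hI hRt ht0 ht1.le
  have par1 := parallelogram_law_with_norm ℝ px py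
  have par2 := parallelogram_law_with_norm ℝ gx gy
  rw [hsum] at par1
  -- trace
  obtain ⟨Sf, b, hSb, hb⟩ := Orthonormal.exists_orthonormalBasis_extension (𝕜 := ℝ) (v := {e})
    (by
      constructor
      · rintro ⟨i, hi⟩; rw [mem_singleton_iff] at hi; simpa [hi] using hen
      · rintro ⟨i, hi⟩ ⟨j, hj⟩ hij
        rw [mem_singleton_iff] at hi hj
        exact absurd (by simp [hi, hj]) hij)
  have heS : e ∈ Sf := hSb (mem_singleton e)
  have hbe : b ⟨e, heS⟩ = e := by rw [hb]
  have tr : ∀ z ∈ Ω, ∑ i, (fderiv ℝ (fderiv ℝ φ) z (b i) (b i) / φ z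
      - ⟪(φ z)⁻¹ • gradient φ z, b i⟫^2) = q z - lam - ‖(φ z)⁻¹ • gradient φ z‖^2 := by
    intro z hz
    have hp := B.hφpos z hz
    rw [Finset.sum_sub_distrib, ← Finset.sum_div, OrthonormalBasis.sum_sq_inner_left]
    have := heig z hz Sf b
    have h2 : ∑ i, fderiv ℝ (fderiv ℝ φ) z (b i) (b i) = (q z - lam) * φ z := by linarith
    rw [h2]; field_simp
  have hS2 : ((fderiv ℝ (fderiv ℝ φ) x e e / φ x - ⟪px, e⟫^2)
      - (fderiv ℝ (fderiv ℝ φ) x' e e / φ x' - ⟪gx, e⟫^2)) +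
    ((fderiv ℝ (fderiv ℝ φ) y e e / φ y - ⟪py, e⟫^2)
      - (fderiv ℝ (fderiv ℝ φ) y' e e / φ y' - ⟪gy, e⟫^2)) ≤ 2 * w2 a - 2 * w2 (t * a) := by
    simp only [map_neg, neg_apply, inner_neg_right, neg_neg, neg_sq] at S2
    linarith
  have hle : ∑ i, (((fderiv ℝ (fderiv ℝ φ) x (b i) (b i) / φ x - ⟪px, b i⟫^2)
      - (fderiv ℝ (fderiv ℝ φ) x' (b i) (b i) / φ x' - ⟪gx, b i⟫^2)) +
    ((fderiv ℝ (fderiv ℝ φ) y (b i) (b i) / φ y - ⟪py, b i⟫^2)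
      - (fderiv ℝ (fderiv ℝ φ) y' (b i) (b i) / φ y' - ⟪gy, b i⟫^2)))
      ≤ 2 * w2 a - 2 * w2 (t * a) := by
    rw [← Finset.add_sum_erase _ _ (Finset.mem_univ (⟨e, heS⟩ : Sf)), hbe]
    have : ∑ i ∈ Finset.univ.erase (⟨e, heS⟩ : Sf),
      (((fderiv ℝ (fderiv ℝ φ) x (b i) (b i) / φ x - ⟪px, b i⟫^2)
      - (fderiv ℝ (fderiv ℝ φ) x' (b i) (b i) / φ x' - ⟪gx, b i⟫^2)) +
    ((fderiv ℝ (fderiv ℝ φ) y (b i) (b i) / φ y - ⟪py, b i⟫^2)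
      - (fderiv ℝ (fderiv ℝ φ) y' (b i) (b i) / φ y' - ⟪gy, b i⟫^2))) ≤ 0 := by
      apply Finset.sum_nonpos
      intro i _
      have := T2 (b i)
      linarith
    linarith
  have tr1 : ∑ i, (fderiv ℝ (fderiv ℝ φ) x (b i) (b i) / φ x - ⟪px, b i⟫^2)
      = q x - lam - ‖px‖^2 := tr x hx
  have tr2 : ∑ i, (fderiv ℝ (fderiv ℝ φ) y (b i) (b i) / φ y - ⟪py, b i⟫^2)
      = q y - lam - ‖py‖^2 := tr y hy
  have tr3 : ∑ i, (fderiv ℝ (fderiv ℝ φ) x' (b i) (b i) / φ x' - ⟪gx, b i⟫^2)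
      = q x' - lam - ‖gx‖^2 := tr x' hx'
  have tr4 : ∑ i, (fderiv ℝ (fderiv ℝ φ) y' (b i) (b i) / φ y' - ⟪gy, b i⟫^2)
      = q y' - lam - ‖gy‖^2 := tr y' hy'
  simp only [Finset.sum_add_distrib, Finset.sum_sub_distrib] at hle tr1 tr2 tr3 tr4
  have hqc : q x' + q y' ≤ q x + q y := by
    have p1 : (0:ℝ) ≤ (1+t)/2 := by linarith
    have p2 : (0:ℝ) ≤ (1-t)/2 := by linarith
    have a1 := hq.2 (subset_closure hx) (subset_closure hy) p1 p2 (by ring)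
    have a2 := hq.2 (subset_closure hx) (subset_closure hy) p2 p1 (by ring)
    have i1 : ((1+t)/2) • x + ((1-t)/2) • y = x' := by rw [hxd, hyd, hxd']; module
    have i2 : ((1-t)/2) • x + ((1+t)/2) • y = y' := by rw [hxd, hyd, hyd']; module
    rw [i1] at a1
    rw [i2] at a2
    simp only [smul_eq_mul] at a1 a2
    linarith
  have hdec := hw.dec a (t * a) hb0 hba huR
  linarith

/-- Main comparison: the four point function is nonpositive. -/
lemma ZZ_nonpos (B : BD Ω ρ φ) (hw : WD w w1 w2 R)
    (hR : ∀ x ∈ closure Ω, ∀ y ∈ closure Ω, ‖x - y‖ < 2 * R)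
    {q : E → ℝ} {lam : ℝ} (hq : ConvexOn ℝ (closure Ω) q)
    (heig : ∀ x ∈ Ω, ∀ (S : Finset E) (b : OrthonormalBasis S ℝ E),
      ∑ i, fderiv ℝ (fderiv ℝ φ) x (b i) (b i) - q x * φ x = - lam * φ x)
    {m u : E} {t : ℝ} (hx : m + u ∈ Ω) (hy : m - u ∈ Ω) (ht : t ∈ Icc (0:ℝ) 1) :
    ZZ φ w (m, u, t) ≤ 0 := by
  by_contra hcon
  push Not at hcon
  obtain ⟨⟨m', u', t'⟩, h1, h2, h3, h4, h5⟩ := B.exists_max hw hR (p0 := (m, u, t)) hx hy ht hcon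
  have hu : u' ≠ 0 := by
    rintro rfl
    simp [ZZ] at h4
  have ht1 : t' < 1 := by
    refine lt_of_le_of_ne h3.2 ?_
    rintro h
    have h : t' = 1 := h
    simp [ZZ, h] at h4
  refine B.no_max hw hR hq heig h1 h2 h3.1 ht1 hu fun m2 u2 t2 a b c => ?_
  rcases le_total 0 t2 with h | h
  · exact h5 (m2, u2, t2) a b ⟨h, c.2⟩
  · have := h5 (m2, u2, -t2) a b ⟨by simpa using h, by linarith [c.1]⟩
    refine le_trans (le_of_eq ?_) this
    simp only [ZZ, neg_smul, sub_neg_eq_add, neg_mul, hw.even]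
    rw [← sub_eq_add_neg]
    ring

end BD

lemma wd_model {κ ε : ℝ} (hκ : 0 < κ) (hε : 0 < ε) (hle : ε ≤ κ^2) :
    WD (fun s => Real.log (Real.cos (κ * s)) + ε * s^2 / 2)
      (fun s => -κ * Real.tan (κ * s) + ε * s)
      (fun s => -κ^2 * (1 + Real.tan (κ * s)^2) + ε) (Real.pi / (2 * κ)) := by
  have hcos : ∀ s, |s| < Real.pi / (2 * κ) → 0 < Real.cos (κ * s) := by
    intro s hs
    rw [abs_lt, lt_div_iff₀ (by positivity), ← neg_div, div_lt_iff₀ (by positivity)] at hs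
    apply Real.cos_pos_of_mem_Ioo
    constructor <;> linarith [hs.1, hs.2]
  have hl : ∀ s : ℝ, HasDerivAt (fun s : ℝ => κ * s) κ s := fun s => by
    simpa using (hasDerivAt_id s).const_mul κ
  refine ⟨fun s hs => ?_, fun s hs => ?_, fun s => by simp, fun a b hb hba ha => ?_⟩
  · have hc := hcos s hs
    have h1 := ((hl s).cos).log hc.ne'
    have h2 := ((hasDerivAt_pow 2 s).const_mul ε).div_const 2
    refine (h1.add h2).congr_deriv ?_
    rw [Real.tan_eq_sin_div_cos]
    field_simp
    simp
    ring
  · have hc := hcos s hs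
    have h1 := ((Real.hasDerivAt_tan hc.ne').comp s (hl s)).const_mul (-κ)
    have h2 := (hasDerivAt_id s).const_mul ε
    refine (h1.add h2).congr_deriv ?_
    rw [Real.tan_eq_sin_div_cos]
    have := Real.sin_sq_add_cos_sq (κ * s)
    field_simp
    linear_combination (κ^2) * this
  · have haR : a * (2 * κ) < Real.pi := by rwa [lt_div_iff₀ (by positivity)] at ha
    have m : Real.tan (κ * b) < Real.tan (κ * a) := by
      apply Real.tan_lt_tan_of_nonneg_of_lt_pi_div_two (by positivity) (by linarith)
      nlinarith
    have t : κ * a < Real.tan (κ * a) := Real.lt_tan (mul_pos hκ (by linarith)) (by linarith)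
    have ha0 : 0 < a := by linarith
    have key : ε * (a^2 - b^2) < 2 * κ * (a * Real.tan (κ * a) - b * Real.tan (κ * b)) := by
      have k1 : (a - b) * (κ * a) ≤ a * Real.tan (κ * a) - b * Real.tan (κ * b) := by
        nlinarith [mul_nonneg hb (sub_nonneg.2 m.le), mul_nonneg (sub_nonneg.2 hba.le) (sub_nonneg.2 t.le)]
      have k2 : ε * (a^2 - b^2) ≤ κ^2 * (a^2 - b^2) :=
        mul_le_mul_of_nonneg_right hle (by nlinarith)
      have k3 : 0 < κ^2 * ((a - b) * (a - b)) := by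
        have := sub_pos.2 hba; positivity
      nlinarith
    have := mul_lt_mul_of_pos_left key hε
    nlinarith

namespace BD

variable {E : Type*} [NormedAddCommGroup E] [InnerProductSpace ℝ E] [FiniteDimensional ℝ E]
    {Ω : Set E} {ρ φ : E → ℝ} {w w1 w2 : ℝ → ℝ} {R : ℝ}

lemma grad_log (B : BD Ω ρ φ) {z : E} (hz : z ∈ Ω) (ξ : E) :
    ⟪gradient (fun z => Real.log (φ z)) z, ξ⟫ = fderiv ℝ φ z ξ / φ z := by
  have h := (B.hasF1 hz).log (B.hφpos z hz).ne'
  simp only [gradient, InnerProductSpace.toDual_symm_apply]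
  rw [h.fderiv]
  simp
  ring

lemma der_bound (B : BD Ω ρ φ) (hw : WD w w1 w2 R)
    (hR : ∀ x ∈ closure Ω, ∀ y ∈ closure Ω, ‖x - y‖ < 2 * R)
    {q : E → ℝ} {lam : ℝ} (hq : ConvexOn ℝ (closure Ω) q)
    (heig : ∀ x ∈ Ω, ∀ (S : Finset E) (b : OrthonormalBasis S ℝ E),
      ∑ i, fderiv ℝ (fderiv ℝ φ) x (b i) (b i) - q x * φ x = - lam * φ x)
    {m u : E} (hx : m + u ∈ Ω) (hy : m - u ∈ Ω) :
    fderiv ℝ φ (m + u) u / φ (m + u) - fderiv ℝ φ (m - u) u / φ (m - u)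
      ≤ 2 * (w1 ‖u‖ * ‖u‖) := by
  have huR : ‖u‖ < R := u_lt (subset_closure hx) (subset_closure hy) hR
  have l1 := B.line1 (z := m) (ξ := u) (s := 1) (by simpa using hx)
  have l2 := B.line1 (z := m) (ξ := -u) (s := 1) (by simpa [← sub_eq_add_neg] using hy)
  have i1 : HasDerivAt (fun s : ℝ => s * ‖u‖) ‖u‖ 1 := by
    simpa using (hasDerivAt_id (1:ℝ)).mul_const ‖u‖
  have i2 : HasDerivAt w (w1 ‖u‖) (1 * ‖u‖) := by
    rw [one_mul]; exact hw.h1 _ (by rwa [abs_of_nonneg (norm_nonneg _)])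
  have i3 := ((HasDerivAt.comp (1:ℝ) i2 i1).const_mul 2).sub_const (2 * w ‖u‖)
  have hd := (((l1.const_sub (Real.log (φ (m + u)))).add
    (l2.const_sub (Real.log (φ (m - u))))).add i3)
  have hd' : HasDerivAt (fun t => ZZ φ w (m, u, t)) (-(fderiv ℝ φ (m + u) u / φ (m + u))
      + fderiv ℝ φ (m - u) u / φ (m - u) + 2 * (w1 ‖u‖ * ‖u‖)) 1 := by
    refine (hd.congr_of_eventuallyEq (Eventually.of_forall fun t => ?_)).congr_deriv ?_
    · simp [ZZ, sub_eq_add_neg]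
    · simp only [one_smul, ← sub_eq_add_neg, map_neg]
      ring
  have h1 : ZZ φ w (m, u, 1) = 0 := by simp [ZZ]
  have hs := (hasDerivAt_iff_tendsto_slope.1 hd').mono_left
    (nhdsWithin_mono (1:ℝ) (fun t (ht : t ∈ Iio (1:ℝ)) => ne_of_lt ht))
  have : 0 ≤ -(fderiv ℝ φ (m + u) u / φ (m + u))
      + fderiv ℝ φ (m - u) u / φ (m - u) + 2 * (w1 ‖u‖ * ‖u‖) := by
    refine ge_of_tendsto hs ?_
    filter_upwards [Ioo_mem_nhdsLT (show (0:ℝ) < 1 by norm_num)] with t ht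
    rw [slope_def_field, h1]
    apply div_nonneg_of_nonpos
    · have := B.ZZ_nonpos hw hR hq heig hx hy (t := t) ⟨ht.1.le, ht.2.le⟩
      linarith
    · linarith [ht.2]
  linarith

end BD

lemma fderiv_fderiv_app {E : Type*} [NormedAddCommGroup E] [NormedSpace ℝ E] {f : E → ℝ} {x : E}
    (h : ContDiffAt ℝ 2 f x) (v : E) :
    fderiv ℝ (fun y => fderiv ℝ f y v) x v = fderiv ℝ (fderiv ℝ f) x v v := by
  have : DifferentiableAt ℝ (fderiv ℝ f) x :=
    (h.fderiv_right (m := 1) (by norm_num)).differentiableAt (by norm_num)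
  rw [fderiv_clm_apply this (differentiableAt_const v)]
  simp

lemma lap_onb {n : ℕ} {f : EuclideanSpace ℝ (Fin n) → ℝ} {x : EuclideanSpace ℝ (Fin n)}
    (h : ContDiffAt ℝ 2 f x) {ι : Type*} [Fintype ι]
    (b : OrthonormalBasis ι ℝ (EuclideanSpace ℝ (Fin n))) :
    ∑ i, fderiv ℝ (fderiv ℝ f) x (b i) (b i) = lap f x := by
  have e1 := congrFun (InnerProductSpace.laplacian_eq_iteratedFDeriv_orthonormalBasis f b) x
  have e2 := congrFun (InnerProductSpace.laplacian_eq_iteratedFDeriv_orthonormalBasis f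
    (EuclideanSpace.basisFun (Fin n) ℝ)) x
  rw [e1] at e2
  simp only [iteratedFDeriv_two_apply] at e2
  unfold lap
  simp only [fderiv_fderiv_app h]
  simpa using e2

lemma strict_diam {E : Type*} [NormedAddCommGroup E] [NormedSpace ℝ E] {Ω : Set E} (hΩ : IsOpen Ω)
    (hbd : Bornology.IsBounded Ω) {x y : E} (hx : x ∈ Ω) (hy : y ∈ Ω) (hxy : x ≠ y) :
    ‖y - x‖ < Metric.diam Ω := by
  have hpos : 0 < ‖y - x‖ := norm_pos_iff.2 (sub_ne_zero.2 hxy.symm)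
  have c : ContinuousAt (fun s : ℝ => y + s • (y - x)) 0 := by fun_prop
  have ev := c.tendsto.eventually (hΩ.mem_nhds (by simpa using hy))
  obtain ⟨s, hs, hs0⟩ := ((ev.filter_mono nhdsWithin_le_nhds).and
    (self_mem_nhdsWithin : Ioi (0:ℝ) ∈ 𝓝[>] 0)).exists
  have hs0 : 0 < s := hs0
  have := Metric.dist_le_diam_of_mem hbd hs hx
  rw [dist_eq_norm, show y + s • (y - x) - x = (1 + s) • (y - x) by module, norm_smul,
    Real.norm_eq_abs, abs_of_pos (by linarith)] at this
  nlinarith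

lemma final_bound {n : ℕ}
    {Ω : Set (EuclideanSpace ℝ (Fin n))} {ρ φ : EuclideanSpace ℝ (Fin n) → ℝ} (B : BD Ω ρ φ)
    {D : ℝ} (hD : Metric.diam Ω = D)
    {q : EuclideanSpace ℝ (Fin n) → ℝ} {lam : ℝ}
    (hq : ConvexOn ℝ (closure Ω) q)
    (heig : ∀ x ∈ Ω, lap φ x - q x * φ x = -lam * φ x)
    {x y : EuclideanSpace ℝ (Fin n)} (hx : x ∈ Ω) (hy : y ∈ Ω) (hxy : x ≠ y) :
      2 * (Real.pi / D) * Real.tan (Real.pi * ‖y - x‖ / (2 * D)) ≤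
        -⟪gradient (fun z => Real.log (φ z)) y - gradient (fun z => Real.log (φ z)) x,
          ‖y - x‖⁻¹ • (y - x)⟫ := by
  have hpos : 0 < ‖y - x‖ := norm_pos_iff.2 (sub_ne_zero.2 hxy.symm)
  have hlt : ‖y - x‖ < D := hD ▸ strict_diam B.hΩ B.hbd hx hy hxy
  have hD0 : 0 < D := hpos.trans hlt
  have hπ := Real.pi_pos
  set L := -⟪gradient (fun z => Real.log (φ z)) y - gradient (fun z => Real.log (φ z)) x,
          ‖y - x‖⁻¹ • (y - x)⟫ with hL
  set a := ‖y - x‖ / 2 with ha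
  have heig' : ∀ x ∈ Ω, ∀ (S : Finset (EuclideanSpace ℝ (Fin n)))
      (b : OrthonormalBasis S ℝ (EuclideanSpace ℝ (Fin n))),
      ∑ i, fderiv ℝ (fderiv ℝ φ) x (b i) (b i) - q x * φ x = - lam * φ x := by
    intro z hz S b
    have hc : ContDiffAt ℝ 2 φ z := B.hφC.contDiffAt
      (mem_of_superset (B.hΩ.mem_nhds hz) subset_closure)
    rw [lap_onb hc b]
    exact heig z hz
  have step : ∀ κ ε : ℝ, 0 < κ → κ < Real.pi / D → 0 < ε → ε ≤ κ^2 →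
      2 * κ * Real.tan (κ * a) - 2 * ε * a ≤ L := by
    intro κ ε hκ hκD hε hle
    have hR : ∀ x ∈ closure Ω, ∀ y ∈ closure Ω, ‖x - y‖ < 2 * (Real.pi / (2 * κ)) := by
      intro x hx y hy
      have h1 := Metric.dist_le_diam_of_mem B.hbd.closure hx hy
      rw [Metric.diam_closure, hD, dist_eq_norm] at h1
      have h2 : D < Real.pi / κ := by
        rw [lt_div_iff₀ hκ]
        rw [lt_div_iff₀ hD0] at hκD
        linarith
      have h3 : 2 * (Real.pi / (2 * κ)) = Real.pi / κ := by field_simp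
      rw [h3]; linarith
    have e1 : (1/2:ℝ) • (x + y) + (1/2:ℝ) • (y - x) = y := by module
    have e2 : (1/2:ℝ) • (x + y) - (1/2:ℝ) • (y - x) = x := by module
    have hb := B.der_bound (wd_model hκ hε hle) hR hq heig' (m := (1/2:ℝ) • (x + y))
      (u := (1/2:ℝ) • (y - x)) (by rw [e1]; exact hy) (by rw [e2]; exact hx)
    have hn : ‖(1/2:ℝ) • (y - x)‖ = a := by
      rw [norm_smul, ha]; norm_num; ring
    rw [e1, e2, hn, ← B.grad_log hy, ← B.grad_log hx, ← inner_sub_left, inner_smul_right] at hb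
    set I := ⟪gradient (fun z => Real.log (φ z)) y - gradient (fun z => Real.log (φ z)) x, y - x⟫
    have hL' : L * ‖y - x‖ = - I := by
      rw [hL, inner_smul_right]; field_simp; rfl
    have hn2 : ‖y - x‖ = 2 * a := by rw [ha]; ring
    have ha0 : 0 < a := by positivity
    rw [hn2] at hL'
    refine le_of_mul_le_mul_right ?_ ha0
    nlinarith
  have lim : Tendsto (fun η : ℝ => 2 * (Real.pi / D - η) * Real.tan ((Real.pi / D - η) * a) - 2 * η * a)
      (𝓝[>] 0) (𝓝 (2 * (Real.pi / D) * Real.tan (Real.pi * ‖y - x‖ / (2 * D)))) := by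
    have e : Real.pi * ‖y - x‖ / (2 * D) = (Real.pi / D - 0) * a := by rw [ha]; field_simp; ring
    have hc : Real.cos ((Real.pi / D - 0) * a) ≠ 0 := by
      apply ne_of_gt
      apply Real.cos_pos_of_mem_Ioo
      have h1 : (Real.pi / D - 0) * a = Real.pi / 2 * (‖y - x‖ / D) := by rw [ha]; field_simp; ring
      have h2 : ‖y - x‖ / D < 1 := by rwa [div_lt_one hD0]
      have h3 : 0 < ‖y - x‖ / D := by positivity
      rw [h1]
      constructor <;> nlinarith
    have ct : ContinuousAt (fun η : ℝ => Real.tan ((Real.pi / D - η) * a)) 0 :=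
      ContinuousAt.comp (f := fun η : ℝ => (Real.pi / D - η) * a) (g := Real.tan)
        (Real.continuousAt_tan.2 hc) (by fun_prop)
    have c : ContinuousAt (fun η : ℝ => 2 * (Real.pi / D - η) * Real.tan ((Real.pi / D - η) * a)
        - 2 * η * a) 0 := by fun_prop
    have := c.tendsto.mono_left (nhdsWithin_le_nhds (s := Ioi 0))
    rw [e]
    simpa using this
  refine le_of_tendsto lim ?_
  have hK : 0 < Real.pi / D := by positivity
  have c1 : ContinuousAt (fun η : ℝ => (Real.pi / D - η)^2 - η) 0 := by fun_prop
  have v1 := c1.tendsto.eventually (lt_mem_nhds (show (0:ℝ) < (Real.pi / D - 0)^2 - 0 by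
    simp only [sub_zero]; positivity))
  filter_upwards [self_mem_nhdsWithin, (gt_mem_nhds hK).filter_mono nhdsWithin_le_nhds,
    v1.filter_mono nhdsWithin_le_nhds] with η h0 h1 h2
  have h0 : 0 < η := h0
  exact step _ η (by linarith) (by linarith) h0 (by linarith)

end

theorem stmt_3 {n : ℕ}
    (Ω : Set (EuclideanSpace ℝ (Fin n))) (ρ : EuclideanSpace ℝ (Fin n) → ℝ)
    (hΩ : IsOpen Ω) (hbd : Bornology.IsBounded Ω)
    (hρ : ContDiff ℝ 2 ρ)
    (hΩρ : Ω = {x | ρ x < 0})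
    (hfr : frontier Ω = {x | ρ x = 0})
    (hν : ∀ x ∈ frontier Ω, gradient ρ x ≠ 0)
    (hsc : ∀ x ∈ frontier Ω, ∀ v : EuclideanSpace ℝ (Fin n), v ≠ 0 → ⟪gradient ρ x, v⟫ = 0 →
      0 < fderiv ℝ (fun y => fderiv ℝ ρ y v) x v)
    (D : ℝ) (hD : Metric.diam Ω = D)
    (q : EuclideanSpace ℝ (Fin n) → ℝ)
    (hq : ConvexOn ℝ (closure Ω) q) (hqC : ContDiffOn ℝ 1 q (closure Ω))
    (φ₀ : EuclideanSpace ℝ (Fin n) → ℝ) (lam0 : ℝ)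
    (hφC : ContDiffOn ℝ 2 φ₀ (closure Ω))
    (hφpos : ∀ x ∈ Ω, 0 < φ₀ x)
    (hφbd : ∀ x ∈ frontier Ω, φ₀ x = 0)
    (hφν : ∀ x ∈ frontier Ω, fderivWithin ℝ φ₀ (closure Ω) x (gradient ρ x) < 0)
    (heig : ∀ x ∈ Ω, lap φ₀ x - q x * φ₀ x = -lam0 * φ₀ x)
 :
    ∀ x ∈ Ω, ∀ y ∈ Ω, x ≠ y →
      2 * (Real.pi / D) * Real.tan (Real.pi * ‖y - x‖ / (2 * D)) ≤
        -⟪gradient (fun z => Real.log (φ₀ z)) y - gradient (fun z => Real.log (φ₀ z)) x,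
          ‖y - x‖⁻¹ • (y - x)⟫ := by
  intro x hx y hy hxy
  have B : BD Ω ρ φ₀ :=
    { hΩ := hΩ, hbd := hbd, hconv := hq.1, hne := ⟨x, hx⟩, hρ := hρ, hΩρ := hΩρ, hfr := hfr
      hν := hν
      hsc := fun z hz v hv h => by
        rw [← fderiv_fderiv_app hρ.contDiffAt]
        exact hsc z hz v hv h
      hφC := hφC, hφpos := hφpos, hφbd := hφbd, hφν := hφν }
  exact final_bound B hD hq heig hx hy hxy
end

section
/- Let Ω ⊂ ℝⁿ be a bounded domain with diameter D, fix z ∈ ℝⁿ and T > 0. Let X(x, t) be a time-dependent vector field on Ω × (0, T], C² in x and C¹ in t, which is symmetric (⟨∇_{W₁} X, W₂⟩ = ⟨∇_{W₂} X, W₁⟩ for all vectors W₁, W₂, i.e. ∂_j X^k = ∂_k X^j) and satisfies (∂/∂t − Δ)X(x, t) = V(x, X(x, t)) − 2∇_X X(x, t) − (1/t)⟨∇_{(·)} X(x, t), x − z⟩ − (1/t)X(x, t), where ⟨∇_{(·)} X, x − z⟩ is the vector whose k-th component is Σ_j ∂_k X^j (x − z)^j, V : Ω × ℝⁿ → ℝⁿ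 is C¹, and for each t the vector field x ↦ V(x, X(x, t)) satisfies (V(y, X(y, t)) − V(x, X(x, t))) · (y − x) ≥ 0 for all x, y ∈ Ω. Let ψ(s, t) be a C^{2,1} function on [0, D/2) × (0, T] with ψ(0, t) = 0, ψ'(s, t) < 0 for s > 0 (prime denoting ∂/∂s), satisfying ψ_t − ψ'' ≥ 2ψψ' − ψ/t − (s/t)ψ'. Define C(x, y, t) = t(⟨X(y, t) − X(x, t), (y − x)/|y − x|⟩ + 2ψ(|y − x|/2, t)) for x ≠ y, and C(x, x, t) = 0. Then there is no (x₀, y₀, t₀) with x₀, y₀ ∈ Ω and t₀ ∈ (0, T] such that C(x₀, y₀, t₀) < 0 and C(x₀, y₀, t₀) ≤ C(x, y, t) for all x, y ∈ Ω and all t ∈ (0, t₀]. -/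
open scoped RealInnerProductSpace
open Set MeasureTheory

lemma second_test_s6 (g g' : ℝ → ℝ) (c : ℝ) (hmin : IsLocalMin g 0)
    (h1 : ∀ᶠ s in nhds (0:ℝ), HasDerivAt g (g' s) s) (h2 : HasDerivAt g' c 0) : 0 ≤ c := by
  by_contra hc
  push Not at hc
  have hd : deriv g =ᶠ[nhds 0] g' := h1.mono fun s hs => hs.deriv
  have hdd : deriv (deriv g) 0 = c := by rw [hd.deriv_eq]; exact h2.deriv
  have h0 : deriv g 0 = 0 := hmin.deriv_eq_zero
  have hmax : IsLocalMax g 0 := by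
    apply isLocalMax_of_deriv_deriv_neg
    · rw [hdd]; exact hc
    · exact h0
    · exact h1.self_of_nhds.continuousAt
  have hconst : g =ᶠ[nhds 0] fun _ => g 0 := by
    filter_upwards [hmin, hmax] with s a b
    exact le_antisymm b a
  have : deriv g =ᶠ[nhds 0] fun _ => 0 := by
    have := hconst.deriv
    simpa using this
  have h3 := this.deriv_eq
  rw [hdd] at h3
  simp at h3
  linarith

section
variable {n : ℕ}

lemma line_deriv (F : EuclideanSpace ℝ (Fin n) → EuclideanSpace ℝ (Fin n))
    {Ω : Set (EuclideanSpace ℝ (Fin n))} (hΩ : IsOpen Ω) (hF : ContDiffOn ℝ 2 F Ω)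
    (y b : EuclideanSpace ℝ (Fin n)) (s : ℝ) (hs : y + s • b ∈ Ω) :
    HasDerivAt (fun s : ℝ => F (y + s • b)) (fderiv ℝ F (y + s • b) b) s := by
  have h1 : HasFDerivAt F (fderiv ℝ F (y + s • b)) (y + s • b) :=
    ((hF.contDiffAt (hΩ.mem_nhds hs)).differentiableAt (by norm_num)).hasFDerivAt
  have h2 : HasDerivAt (fun s : ℝ => y + s • b) b s := by
    simpa using ((hasDerivAt_id s).smul_const b).const_add y
  exact h1.comp_hasDerivAt s h2

lemma fderiv_diff (F : EuclideanSpace ℝ (Fin n) → EuclideanSpace ℝ (Fin n))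
    {Ω : Set (EuclideanSpace ℝ (Fin n))} (hΩ : IsOpen Ω) (hF : ContDiffOn ℝ 2 F Ω)
    (y : EuclideanSpace ℝ (Fin n)) (hs : y ∈ Ω) : DifferentiableAt ℝ (fderiv ℝ F) y := by
  have := (hF.contDiffAt (hΩ.mem_nhds hs)).fderiv_right (m := 1) (by norm_num)
  exact this.differentiableAt (by norm_num)

lemma line_deriv2 (F : EuclideanSpace ℝ (Fin n) → EuclideanSpace ℝ (Fin n))
    {Ω : Set (EuclideanSpace ℝ (Fin n))} (hΩ : IsOpen Ω) (hF : ContDiffOn ℝ 2 F Ω)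
    (y b : EuclideanSpace ℝ (Fin n)) (hs : y ∈ Ω) :
    HasDerivAt (fun s : ℝ => fderiv ℝ F (y + s • b) b) (fderiv ℝ (fderiv ℝ F) y b b) 0 := by
  have h1 : HasFDerivAt (fderiv ℝ F) (fderiv ℝ (fderiv ℝ F) y) (y + (0:ℝ) • b) := by
    simpa using (fderiv_diff F hΩ hF y hs).hasFDerivAt
  have h2 : HasDerivAt (fun s : ℝ => y + s • b) b 0 := by
    simpa using ((hasDerivAt_id (0:ℝ)).smul_const b).const_add y
  have h3 := h1.comp_hasDerivAt (0:ℝ) h2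
  exact (h3.clm_apply (hasDerivAt_const (0:ℝ) b)).congr_deriv (by simp)

lemma line_mem {Ω : Set (EuclideanSpace ℝ (Fin n))} (hΩ : IsOpen Ω)
    (y b : EuclideanSpace ℝ (Fin n)) (hs : y ∈ Ω) : ∀ᶠ s in nhds (0:ℝ), y + s • b ∈ Ω := by
  have : ContinuousAt (fun s : ℝ => y + s • b) 0 := by fun_prop
  exact this.eventually_mem (hΩ.mem_nhds (by simpa using hs))

lemma second_order (F : EuclideanSpace ℝ (Fin n) → EuclideanSpace ℝ (Fin n))
    {Ω : Set (EuclideanSpace ℝ (Fin n))} (hΩ : IsOpen Ω) (hF : ContDiffOn ℝ 2 F Ω)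
    (x y a b e : EuclideanSpace ℝ (Fin n)) (hx : x ∈ Ω) (hy : y ∈ Ω)
    (p p' : ℝ → ℝ) (p'' s₀ c : ℝ) (hp : ∀ᶠ s in nhds s₀, HasDerivAt p (p' s) s)
    (hp' : HasDerivAt p' p'' s₀)
    (hmin : IsLocalMin (fun s : ℝ => ⟪F (y + s • b) - F (x + s • a), e⟫ + 2 * p (s₀ + c * s)) 0) :
    0 ≤ ⟪fderiv ℝ (fderiv ℝ F) y b b - fderiv ℝ (fderiv ℝ F) x a a, e⟫ + 2 * c ^ 2 * p'' := by
  have hl : ∀ s : ℝ, HasDerivAt (fun s => s₀ + c * s) c s := fun s => by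
    simpa using ((hasDerivAt_id s).const_mul c).const_add s₀
  have hcont : Filter.Tendsto (fun s : ℝ => s₀ + c * s) (nhds 0) (nhds s₀) := by
    have : ContinuousAt (fun s : ℝ => s₀ + c * s) 0 := by fun_prop
    simpa [ContinuousAt] using this
  refine second_test_s6 _ (fun s => ⟪fderiv ℝ F (y + s • b) b - fderiv ℝ F (x + s • a) a, e⟫
    + 2 * (p' (s₀ + c * s) * c)) _ hmin ?_ ?_
  · filter_upwards [line_mem hΩ y b hy, line_mem hΩ x a hx, hcont.eventually hp] with s h1 h2 h3
    have := ((line_deriv F hΩ hF y b s h1).sub (line_deriv F hΩ hF x a s h2)).inner ℝ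
      (hasDerivAt_const s e)
    have h4 := (h3.comp s (hl s)).const_mul 2
    exact (this.add h4).congr_deriv (by simp)
  · have := ((line_deriv2 F hΩ hF y b hy).sub (line_deriv2 F hΩ hF x a hx)).inner ℝ
      (hasDerivAt_const (0:ℝ) e)
    have hp'' : HasDerivAt p' p'' (s₀ + c * 0) := by simpa using hp'
    have h4 := ((hp''.comp (0:ℝ) (hl 0)).mul_const c).const_mul 2
    exact (this.add h4).congr_deriv (by simp; ring)

lemma first_order (F : EuclideanSpace ℝ (Fin n) → EuclideanSpace ℝ (Fin n))
    {Ω : Set (EuclideanSpace ℝ (Fin n))} (hΩ : IsOpen Ω) (hF : ContDiffOn ℝ 2 F Ω)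
    (x y a b e : EuclideanSpace ℝ (Fin n)) (hx : x ∈ Ω) (hy : y ∈ Ω)
    (d : ℝ) (hd : 0 < d) (hde : y - x = d • e) (he : ‖e‖ = 1)
    (p : ℝ → ℝ) (p' : ℝ) (hp : HasDerivAt p p' (d / 2))
    (hmin : IsLocalMin (fun s : ℝ => ⟪F (y + s • b) - F (x + s • a),
      ‖(y + s • b) - (x + s • a)‖⁻¹ • ((y + s • b) - (x + s • a))⟫
        + 2 * p (‖(y + s • b) - (x + s • a)‖ / 2)) 0) :
    ⟪fderiv ℝ F y b - fderiv ℝ F x a, e⟫ + d⁻¹ * (⟪F y - F x, b - a⟫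
      - ⟪e, b - a⟫ * ⟪F y - F x, e⟫) + p' * ⟪e, b - a⟫ = 0 := by
  have hN : ‖y - x‖ = d := by rw [hde, norm_smul, he, Real.norm_of_nonneg hd.le, mul_one]
  have hN2 : ‖d • e‖ = d := by rw [← hde, hN]
  have hl : HasDerivAt (fun s : ℝ => (y + s • b) - (x + s • a)) (b - a) 0 := by
    have h1 : HasDerivAt (fun s : ℝ => y + s • b) b 0 := by
      simpa using ((hasDerivAt_id (0:ℝ)).smul_const b).const_add y
    have h2 : HasDerivAt (fun s : ℝ => x + s • a) a 0 := by
      simpa using ((hasDerivAt_id (0:ℝ)).smul_const a).const_add x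
    exact h1.sub h2
  have hn : HasDerivAt (fun s : ℝ => ‖(y + s • b) - (x + s • a)‖) ⟪e, b - a⟫ 0 := by
    have h1 := hl.norm_sq.sqrt (by simp [hN, hd.ne'])
    simp only [Real.sqrt_sq (norm_nonneg _)] at h1
    refine h1.congr_deriv ?_
    simp only [zero_smul, add_zero, hde, hN2, real_inner_smul_left]
    field_simp
  have hi := hn.inv (by simp [hN, hd.ne'])
  have h1 := ((line_deriv F hΩ hF y b 0 (by simpa using hy)).sub
    (line_deriv F hΩ hF x a 0 (by simpa using hx))).inner ℝ (hi.smul hl)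
  have hp2 : HasDerivAt p p' (‖(y + (0:ℝ) • b) - (x + (0:ℝ) • a)‖ / 2) := by
    simpa [hN] using hp
  have h2 := (hp2.comp (0:ℝ) (hn.div_const 2)).const_mul 2
  have h3 := hmin.hasDerivAt_eq_zero (h1.add h2)
  rw [← h3]
  simp only [Pi.inv_apply, Pi.sub_apply, zero_smul, add_zero, inner_add_right,
    inner_smul_right, Pi.smul_apply', hde, hN2]
  field_simp
  ring

lemma trace_lemma (Q : EuclideanSpace ℝ (Fin n) →L[ℝ] EuclideanSpace ℝ (Fin n) →L[ℝ] ℝ)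
    (e : EuclideanSpace ℝ (Fin n)) (he : ‖e‖ = 1) (q : ℝ)
    (h1 : 0 ≤ Q e e + q) (h2 : ∀ w, ⟪w, e⟫ = 0 → 0 ≤ Q w w) :
    0 ≤ ∑ i, Q (EuclideanSpace.single i 1) (EuclideanSpace.single i 1) + q := by
  have hee : ∑ i, e i ^ 2 = 1 := by
    have := EuclideanSpace.real_norm_sq_eq e
    rw [he] at this
    simpa using this.symm
  have hexp : ∑ i, e i • EuclideanSpace.single i (1:ℝ) = e := by
    ext j; simp [Finset.sum_apply, Pi.single_apply]
  have key : ∑ i, Q (EuclideanSpace.single i 1) (EuclideanSpace.single i 1)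
      = ∑ i, Q (EuclideanSpace.single i 1 - e i • e) (EuclideanSpace.single i 1 - e i • e)
        + Q e e := by
    have a1 : ∑ i, e i * Q (EuclideanSpace.single i 1) e = Q e e := by
      conv_rhs => rw [← hexp]
      rw [hexp]
      conv_rhs => enter [1,2]; rw [← hexp]
      simp
    have a2 : ∑ i, e i * Q e (EuclideanSpace.single i 1) = Q e e := by
      conv_rhs => enter [2]; rw [← hexp]
      simp
    have : ∀ i, Q (EuclideanSpace.single i 1 - e i • e) (EuclideanSpace.single i 1 - e i • e)
      = Q (EuclideanSpace.single i 1) (EuclideanSpace.single i 1)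
        - e i * Q (EuclideanSpace.single i 1) e - e i * Q e (EuclideanSpace.single i 1)
        + e i ^ 2 * Q e e := by
      intro i; simp; ring
    simp only [this, Finset.sum_add_distrib, Finset.sum_sub_distrib, a1, a2, ← Finset.sum_mul, hee]
    ring
  have : 0 ≤ ∑ i, Q (EuclideanSpace.single i 1 - e i • e) (EuclideanSpace.single i 1 - e i • e) := by
    refine Finset.sum_nonneg fun i _ => h2 _ ?_
    rw [inner_sub_left, real_inner_smul_left, real_inner_self_eq_norm_sq, he]
    simp [EuclideanSpace.inner_single_left]
  linarith

lemma comp_fderiv (F : EuclideanSpace ℝ (Fin n) → EuclideanSpace ℝ (Fin n))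
    (x v : EuclideanSpace ℝ (Fin n)) (hF : DifferentiableAt ℝ F x) (k : Fin n) :
    fderiv ℝ (fun y => F y k) x v = (fderiv ℝ F x v) k := by
  have := ((EuclideanSpace.proj k : EuclideanSpace ℝ (Fin n) →L[ℝ] ℝ).hasFDerivAt.comp x hF.hasFDerivAt).fderiv
  have h2 : (fun y => F y k) = (EuclideanSpace.proj k : EuclideanSpace ℝ (Fin n) →L[ℝ] ℝ) ∘ F := by
    ext; simp
  rw [h2, this]; simp

lemma comp_lap (F : EuclideanSpace ℝ (Fin n) → EuclideanSpace ℝ (Fin n))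
    {Ω : Set (EuclideanSpace ℝ (Fin n))} (hΩ : IsOpen Ω) (hF : ContDiffOn ℝ 2 F Ω)
    (x : EuclideanSpace ℝ (Fin n)) (hx : x ∈ Ω) (k : Fin n) :
    lap (fun y => F y k) x = ∑ i, (fderiv ℝ (fderiv ℝ F) x (EuclideanSpace.single i 1)
      (EuclideanSpace.single i 1)) k := by
  unfold lap
  refine Finset.sum_congr rfl fun i _ => ?_
  have h1 : (fun y => fderiv ℝ (fun y => F y k) y (EuclideanSpace.single i 1)) =ᶠ[nhds x]
      fun y => (fderiv ℝ F y (EuclideanSpace.single i 1)) k := by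
    filter_upwards [hΩ.mem_nhds hx] with y hy
    exact comp_fderiv F y _ ((hF.contDiffAt (hΩ.mem_nhds hy)).differentiableAt (by norm_num)) k
  have hd := (fderiv_diff F hΩ hF x hx)
  rw [h1.fderiv_eq, comp_fderiv (fun y => fderiv ℝ F y (EuclideanSpace.single i 1)) x _
    (hd.clm_apply (differentiableAt_const _))]
  rw [fderiv_clm_apply hd (differentiableAt_const _)]
  simp

lemma time_test (g : ℝ → ℝ) (c t : ℝ) (ht : 0 < t) (hg : HasDerivWithinAt g c (Ioc 0 t) t)
    (hmin : ∀ s ∈ Ioc 0 t, g t ≤ g s) : c ≤ 0 := by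
  have h1 : IsLocalMinOn g (Ioc 0 t) t := by
    filter_upwards [self_mem_nhdsWithin] with s hs using hmin s hs
  have h2 : t / 2 - t ∈ posTangentConeAt (Ioc 0 t) t := by
    apply sub_mem_posTangentConeAt_of_segment_subset
    rw [segment_symm, segment_eq_Icc (by linarith)]
    intro s hs
    exact ⟨by linarith [hs.1], hs.2⟩
  have h3 := h1.hasFDerivWithinAt_nonneg hg.hasFDerivWithinAt h2
  simp at h3
  nlinarith

lemma inner_comp (a b : EuclideanSpace ℝ (Fin n)) : ⟪a, b⟫ = ∑ k, a k * b k := by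
  simp [PiLp.inner_apply, mul_comm]

lemma sum_comp (L : EuclideanSpace ℝ (Fin n) →L[ℝ] EuclideanSpace ℝ (Fin n))
    (v : EuclideanSpace ℝ (Fin n)) (k : Fin n) :
    ∑ j, v j * (L (EuclideanSpace.single j 1)) k = (L v) k := by
  have hexp : ∑ i, v i • EuclideanSpace.single i (1:ℝ) = v := by
    ext j; simp [Finset.sum_apply, Pi.single_apply]
  conv_rhs => rw [← hexp]
  simp

lemma sym_inner (L : EuclideanSpace ℝ (Fin n) →L[ℝ] EuclideanSpace ℝ (Fin n))
    (hs : ∀ j k, (L (EuclideanSpace.single j 1)) k = (L (EuclideanSpace.single k 1)) j)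
    (v w : EuclideanSpace ℝ (Fin n)) : ⟪L v, w⟫ = ⟪L w, v⟫ := by
  rw [inner_comp, inner_comp]
  have e1 : ∀ k, L v k * w k = ∑ j, v j * (L (EuclideanSpace.single j 1)) k * w k := fun k => by
    rw [← sum_comp L v k, Finset.sum_mul]
  have e2 : ∀ k, L w k * v k = ∑ j, w j * (L (EuclideanSpace.single j 1)) k * v k := fun k => by
    rw [← sum_comp L w k, Finset.sum_mul]
  rw [Finset.sum_congr rfl fun k _ => e1 k, Finset.sum_congr rfl fun k _ => e2 k]
  rw [Finset.sum_comm]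
  refine Finset.sum_congr rfl fun i _ => Finset.sum_congr rfl fun j _ => ?_
  rw [hs]; ring

lemma dist_lt_diam {Ω : Set (EuclideanSpace ℝ (Fin n))} (hΩ : IsOpen Ω)
    (hbd : Bornology.IsBounded Ω) (x y : EuclideanSpace ℝ (Fin n)) (hx : x ∈ Ω) (hy : y ∈ Ω)
    (hxy : x ≠ y) : ‖y - x‖ < Metric.diam Ω := by
  have hpos : 0 < ‖y - x‖ := norm_pos_iff.2 (sub_ne_zero.2 hxy.symm)
  have h1 : ∀ᶠ s in nhdsWithin (0:ℝ) (Ioi 0), y + s • (y - x) ∈ Ω :=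
    (line_mem hΩ y (y - x) hy).filter_mono nhdsWithin_le_nhds
  obtain ⟨s, hs, hs0⟩ := (h1.and self_mem_nhdsWithin).exists
  have hs0 : 0 < s := hs0
  have h2 := Metric.dist_le_diam_of_mem hbd hs hx
  rw [dist_eq_norm, show y + s • (y - x) - x = (1 + s) • (y - x) by module, norm_smul,
    Real.norm_of_nonneg (by linarith)] at h2
  nlinarith

lemma pde_inner (F : EuclideanSpace ℝ (Fin n) → EuclideanSpace ℝ (Fin n))
    {Ω : Set (EuclideanSpace ℝ (Fin n))} (hΩ : IsOpen Ω) (hF : ContDiffOn ℝ 2 F Ω)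
    (x z e W U : EuclideanSpace ℝ (Fin n)) (hx : x ∈ Ω) (t : ℝ)
    (hs : ∀ v w, ⟪fderiv ℝ F x v, w⟫ = ⟪fderiv ℝ F x w, v⟫)
    (h : ∀ k, W k - lap (fun y => F y k) x = U k
        - 2 * ∑ j, F x j * fderiv ℝ (fun y => F y k) x (EuclideanSpace.single j 1)
        - (1/t) * ∑ j, fderiv ℝ (fun y => F y j) x (EuclideanSpace.single k 1) * (x - z) j
        - (1/t) * F x k) :
    ⟪W, e⟫ = (∑ i, ⟪fderiv ℝ (fderiv ℝ F) x (EuclideanSpace.single i 1)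
      (EuclideanSpace.single i 1), e⟫) + ⟪U, e⟫ - 2 * ⟪fderiv ℝ F x (F x), e⟫
      - (1/t) * ⟪fderiv ℝ F x (x - z), e⟫ - (1/t) * ⟪F x, e⟫ := by
  have hd : DifferentiableAt ℝ F x :=
    (hF.contDiffAt (hΩ.mem_nhds hx)).differentiableAt (by norm_num)
  have hW : W = (∑ i, fderiv ℝ (fderiv ℝ F) x (EuclideanSpace.single i 1)
      (EuclideanSpace.single i 1)) + U - (2:ℝ) • fderiv ℝ F x (F x)
      - (1/t) • fderiv ℝ F x (x - z) - (1/t) • F x := by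
    ext k
    have hk := h k
    rw [comp_lap F hΩ hF x hx] at hk
    simp only [comp_fderiv F x _ hd] at hk
    rw [sum_comp, ← inner_comp, hs] at hk
    have : ⟪fderiv ℝ F x (x - z), EuclideanSpace.single k 1⟫ = (fderiv ℝ F x (x - z)) k := by
      simp [EuclideanSpace.inner_single_right]
    rw [this] at hk
    simp only [PiLp.sub_apply, PiLp.add_apply, PiLp.smul_apply, smul_eq_mul, WithLp.ofLp_sum,
      Finset.sum_apply]
    linarith
  rw [hW]
  simp only [inner_sub_left, inner_add_left, real_inner_smul_left, sum_inner]

end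

lemma final_algebra (gy gx p t ny nx vy vx ly lx ry rx m pt ps δ q d : ℝ) {pss : ℝ}
    (htime : gy - gx + 2 * p + t * (ny + vy - 2 * ly - m * ry - m * gy
      - (nx + vx - 2 * lx - m * rx - m * gx) + 2 * pt) ≤ 0)
    (hf1 : ly - lx + q + ps * δ = 0) (hf2 : ry - rx = -(ps * d)) (hin : gy - gx = δ)
    (m1 : 0 ≤ t * (ny - nx + 2 * pss)) (m2 : 0 ≤ t * (vy - vx)) (m3 : 0 ≤ t * q)
    (m4 : 0 < t * (ps * (δ + 2 * p))) (m5 : t * m = 1)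
    (hmul : t * (2 * p * ps) - p - d / 2 * ps ≤ t * (pt - pss)) : False := by
  have k : gy - gx + 2 * p + t * (ny + vy - 2 * ly - m * ry - m * gy
      - (nx + vx - 2 * lx - m * rx - m * gx) + 2 * pt) =
      2 * p + t * (ny - nx + 2 * pss) + t * (vy - vx) + 2 * (t * q) + 2 * (t * (pt - pss))
      - 4 * t * pss + 2 * t * pss + 2 * (t * pss) + 2 * t * ps * δ + ps * d := by
    linear_combination (-2 * t) * hf1 - (ry - rx) * m5 - (gy - gx) * m5 - hf2
  rw [k] at htime
  linarith

theorem stmt_6 {n : ℕ} (Ω : Set (EuclideanSpace ℝ (Fin n)))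
    (hΩ : IsOpen Ω) (hconn : IsConnected Ω) (hbd : Bornology.IsBounded Ω)
    (D T : ℝ) (hD : Metric.diam Ω = D) (hT : 0 < T) (z : EuclideanSpace ℝ (Fin n))
    (X : EuclideanSpace ℝ (Fin n) → ℝ → EuclideanSpace ℝ (Fin n))
    (V : EuclideanSpace ℝ (Fin n) → EuclideanSpace ℝ (Fin n) → EuclideanSpace ℝ (Fin n))
    (hXx : ∀ t ∈ Ioc (0:ℝ) T, ContDiffOn ℝ 2 (fun x => X x t) Ω)
    (hXt : ∀ x ∈ Ω, ContDiffOn ℝ 1 (X x) (Ioc (0:ℝ) T))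
    (hsym : ∀ x ∈ Ω, ∀ t ∈ Ioc (0:ℝ) T, ∀ j k : Fin n,
      fderiv ℝ (fun y => X y t k) x (EuclideanSpace.single j 1) =
      fderiv ℝ (fun y => X y t j) x (EuclideanSpace.single k 1))
    (hV : ContDiffOn ℝ 1 (fun p : EuclideanSpace ℝ (Fin n) × EuclideanSpace ℝ (Fin n) => V p.1 p.2) (Ω ×ˢ univ))
    (heq : ∀ x ∈ Ω, ∀ t ∈ Ioc (0:ℝ) T, ∀ k : Fin n,
      derivWithin (fun τ => X x τ k) (Ioc (0:ℝ) T) t - lap (fun y => X y t k) x =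
      V x (X x t) k
        - 2 * ∑ j, X x t j * fderiv ℝ (fun y => X y t k) x (EuclideanSpace.single j 1)
        - (1/t) * ∑ j, fderiv ℝ (fun y => X y t j) x (EuclideanSpace.single k 1) * (x - z) j
        - (1/t) * X x t k)
    (hVexp : ∀ t ∈ Ioc (0:ℝ) T, ∀ x ∈ Ω, ∀ y ∈ Ω,
      0 ≤ ⟪V y (X y t) - V x (X x t), y - x⟫)
    (ψ ψs ψss ψt : ℝ → ℝ → ℝ)
    (hψ0 : ∀ t ∈ Ioc (0:ℝ) T, ψ 0 t = 0)
    (hψds : ∀ t ∈ Ioc (0:ℝ) T, ∀ s ∈ Ico (0:ℝ) (D/2),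
      HasDerivWithinAt (fun σ => ψ σ t) (ψs s t) (Ico (0:ℝ) (D/2)) s)
    (hψdss : ∀ t ∈ Ioc (0:ℝ) T, ∀ s ∈ Ico (0:ℝ) (D/2),
      HasDerivWithinAt (fun σ => ψs σ t) (ψss s t) (Ico (0:ℝ) (D/2)) s)
    (hψdt : ∀ s ∈ Ico (0:ℝ) (D/2), ∀ t ∈ Ioc (0:ℝ) T,
      HasDerivWithinAt (fun τ => ψ s τ) (ψt s t) (Ioc (0:ℝ) T) t)
    (hψneg : ∀ s ∈ Ioo (0:ℝ) (D/2), ∀ t ∈ Ioc (0:ℝ) T, ψs s t < 0)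
    (hODE : ∀ s ∈ Ico (0:ℝ) (D/2), ∀ t ∈ Ioc (0:ℝ) T,
      ψt s t - ψss s t ≥ 2 * ψ s t * ψs s t - ψ s t / t - (s / t) * ψs s t)
    (C : EuclideanSpace ℝ (Fin n) → EuclideanSpace ℝ (Fin n) → ℝ → ℝ)
    (hCdiag : ∀ x t, C x x t = 0)
    (hC : ∀ x y t, x ≠ y → C x y t =
      t * (⟪X y t - X x t, ‖y - x‖⁻¹ • (y - x)⟫ + 2 * ψ (‖y - x‖ / 2) t)) :
    ¬ ∃ x₀ ∈ Ω, ∃ y₀ ∈ Ω, ∃ t₀ ∈ Ioc (0:ℝ) T, C x₀ y₀ t₀ < 0 ∧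
      ∀ x ∈ Ω, ∀ y ∈ Ω, ∀ t ∈ Ioc (0:ℝ) t₀, C x₀ y₀ t₀ ≤ C x y t := by
  rintro ⟨x, hx, y, hy, t, ht, hneg, hmin⟩
  have hxy : x ≠ y := by
    rintro rfl
    rw [hCdiag] at hneg
    exact lt_irrefl _ hneg
  have ht0 : 0 < t := ht.1
  have hdD : ‖y - x‖ < D := hD ▸ dist_lt_diam hΩ hbd x y hx hy hxy
  obtain ⟨d, hdd⟩ : ∃ d, d = ‖y - x‖ := ⟨_, rfl⟩
  have hd : 0 < d := hdd ▸ norm_pos_iff.2 (sub_ne_zero.2 hxy.symm)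
  rw [← hdd] at hdD
  obtain ⟨e, hee⟩ : ∃ e, e = ‖y - x‖⁻¹ • (y - x) := ⟨_, rfl⟩
  have hde : y - x = d • e := by
    rw [hee, ← hdd, smul_smul, mul_inv_cancel₀ hd.ne', one_smul]
  have he : ‖e‖ = 1 := by
    rw [hee, norm_smul, norm_inv, norm_norm, ← hdd, inv_mul_cancel₀ hd.ne']
  have hee1 : ⟪e, e⟫ = 1 := by rw [real_inner_self_eq_norm_sq, he]; norm_num
  have hs0 : d / 2 ∈ Ioo (0:ℝ) (D/2) := ⟨by linarith, by linarith⟩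
  have hs0' : d / 2 ∈ Ico (0:ℝ) (D/2) := ⟨hs0.1.le, hs0.2⟩
  obtain ⟨F, hFd⟩ : ∃ F : EuclideanSpace ℝ (Fin n) → EuclideanSpace ℝ (Fin n),
    F = fun x => X x t := ⟨_, rfl⟩
  have hF : ContDiffOn ℝ 2 F Ω := hFd ▸ hXx t ht
  have hFx : ∀ x, X x t = F x := fun x => by rw [hFd]
  have hsymF : ∀ x ∈ Ω, ∀ v w, ⟪fderiv ℝ F x v, w⟫ = ⟪fderiv ℝ F x w, v⟫ := by
    intro x hx
    have hdf : DifferentiableAt ℝ F x :=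
      (hF.contDiffAt (hΩ.mem_nhds hx)).differentiableAt (by norm_num)
    refine sym_inner _ fun j k => ?_
    rw [← comp_fderiv F x _ hdf, ← comp_fderiv F x _ hdf, hFd]
    exact hsym x hx t ht j k
  -- derivatives of ψ
  have hp1 : ∀ s ∈ Ioo (0:ℝ) (D/2), HasDerivAt (fun σ => ψ σ t) (ψs s t) s := fun s hs =>
    (hψds t ht s ⟨hs.1.le, hs.2⟩).hasDerivAt
      (Filter.mem_of_superset (Ioo_mem_nhds hs.1 hs.2) Ioo_subset_Ico_self)
  have hp1' : ∀ᶠ s in nhds (d/2), HasDerivAt (fun σ => ψ σ t) (ψs s t) s := by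
    filter_upwards [Ioo_mem_nhds hs0.1 hs0.2] with s hs using hp1 s hs
  have hp2 : HasDerivAt (fun σ => ψs σ t) (ψss (d/2) t) (d/2) :=
    (hψdss t ht _ hs0').hasDerivAt
      (Filter.mem_of_superset (Ioo_mem_nhds hs0.1 hs0.2) Ioo_subset_Ico_self)
  -- spatial minimum
  have hCxy : ∀ τ, C x y τ = τ * (⟪X y τ - X x τ, e⟫ + 2 * ψ (d / 2) τ) := by
    intro τ; rw [hC x y τ hxy, ← hee, ← hdd]
  have hspace : ∀ x' ∈ Ω, ∀ y' ∈ Ω, x' ≠ y' →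
      ⟪F y - F x, e⟫ + 2 * ψ (d / 2) t ≤
      ⟪F y' - F x', ‖y' - x'‖⁻¹ • (y' - x')⟫ + 2 * ψ (‖y' - x'‖ / 2) t := by
    intro x' hx' y' hy' hne
    have := hmin x' hx' y' hy' t ⟨ht0, le_rfl⟩
    rw [hCxy, hC x' y' t hne, hFx, hFx, hFx, hFx] at this
    exact le_of_mul_le_mul_left this ht0
  have hne : ∀ a b : EuclideanSpace ℝ (Fin n), ∀ᶠ s in nhds (0:ℝ), x + s • a ≠ y + s • b := by
    intro a b
    have h1 : ContinuousAt (fun s : ℝ => (x + s • a) - (y + s • b)) 0 := by fun_prop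
    have h2 := h1.eventually_ne (y := 0) (by simpa using sub_ne_zero.2 hxy)
    exact h2.mono fun s hs => sub_ne_zero.1 hs
  have hfirst : ∀ a b, ⟪fderiv ℝ F y b - fderiv ℝ F x a, e⟫ + d⁻¹ * (⟪F y - F x, b - a⟫
      - ⟪e, b - a⟫ * ⟪F y - F x, e⟫) + ψs (d/2) t * ⟪e, b - a⟫ = 0 := by
    intro a b
    refine first_order F hΩ hF x y a b e hx hy d hd hde he (fun σ => ψ σ t) _ (hp1 _ hs0) ?_
    filter_upwards [line_mem hΩ x a hx, line_mem hΩ y b hy, hne a b] with s h1 h2 h3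
    have h5 := hspace _ h1 _ h2 h3
    rw [hee, hdd] at h5
    simpa using h5
  have hsec1 : 0 ≤ ⟪fderiv ℝ (fderiv ℝ F) y e e - fderiv ℝ (fderiv ℝ F) x e e, e⟫
      + 2 * ψss (d/2) t := by
    have h := second_order F hΩ hF x y (-e) e e hx hy (fun σ => ψ σ t) (fun σ => ψs σ t)
      (ψss (d/2) t) (d/2) 1 hp1' hp2 ?_
    · simpa using h
    have hpos : ∀ᶠ s in nhds (0:ℝ), 0 < d + 2 * s := by
      have h1 : ContinuousAt (fun s : ℝ => d + 2 * s) 0 := by fun_prop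
      exact h1.eventually (lt_mem_nhds (by simpa using hd))
    filter_upwards [line_mem hΩ x (-e) hx, line_mem hΩ y e hy, hne (-e) e, hpos] with s h1 h2 h3 h4
    have h5 := hspace _ h1 _ h2 h3
    have h6 : y + s • e - (x + s • -e) = (d + 2 * s) • e := by
      rw [show y + s • e - (x + s • -e) = (y - x) + (2 * s) • e by module, hde]; module
    have h7 : ‖y + s • e - (x + s • -e)‖ = d + 2 * s := by
      rw [h6, norm_smul, he, Real.norm_of_nonneg h4.le, mul_one]
    rw [h7, h6, smul_smul, inv_mul_cancel₀ h4.ne', one_smul,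
      show (d + 2 * s) / 2 = d / 2 + 1 * s by ring] at h5
    simpa using h5
  have hsec2 : ∀ w, ⟪w, e⟫ = 0 →
      0 ≤ ⟪fderiv ℝ (fderiv ℝ F) y w w - fderiv ℝ (fderiv ℝ F) x w w, e⟫ := by
    intro w hw
    have h := second_order F hΩ hF x y w w e hx hy (fun σ => ψ σ t) (fun σ => ψs σ t)
      (ψss (d/2) t) (d/2) 0 hp1' hp2 ?_
    · simpa using h
    filter_upwards [line_mem hΩ x w hx, line_mem hΩ y w hy, hne w w] with s h1 h2 h3
    have h5 := hspace _ h1 _ h2 h3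
    rw [show y + s • w - (x + s • w) = y - x by abel, ← hee, ← hdd] at h5
    simpa using h5
  have htr : 0 ≤ (∑ i, ⟪fderiv ℝ (fderiv ℝ F) y (EuclideanSpace.single i 1)
      (EuclideanSpace.single i 1), e⟫) - (∑ i, ⟪fderiv ℝ (fderiv ℝ F) x (EuclideanSpace.single i 1)
      (EuclideanSpace.single i 1), e⟫) + 2 * ψss (d/2) t := by
    have h := trace_lemma ((ContinuousLinearMap.compL ℝ (EuclideanSpace ℝ (Fin n))
      (EuclideanSpace ℝ (Fin n)) ℝ (innerSL ℝ e)).comp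
        (fderiv ℝ (fderiv ℝ F) y - fderiv ℝ (fderiv ℝ F) x)) e he (2 * ψss (d/2) t)
      (by simpa [real_inner_comm, inner_sub_left, inner_sub_right] using hsec1)
      (fun w hw => by simpa [real_inner_comm, inner_sub_left, inner_sub_right] using hsec2 w hw)
    simpa [real_inner_comm, inner_sub_left, inner_sub_right] using h
  -- time derivative
  have hXd : ∀ x ∈ Ω, HasDerivWithinAt (X x) (derivWithin (X x) (Ioc 0 T) t) (Ioc 0 T) t :=
    fun x hx => ((hXt x hx).differentiableOn (by norm_num) t ht).hasDerivWithinAt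
  have huniq : UniqueDiffWithinAt ℝ (Ioc 0 T) t := uniqueDiffOn_Ioc 0 T t ht
  have hcomp : ∀ x ∈ Ω, ∀ k, derivWithin (fun τ => X x τ k) (Ioc 0 T) t
      = (derivWithin (X x) (Ioc 0 T) t) k := by
    intro x hx k
    have := ((EuclideanSpace.proj k : EuclideanSpace ℝ (Fin n) →L[ℝ] ℝ).hasFDerivAt.comp_hasDerivWithinAt
      t (hXd x hx))
    exact this.derivWithin huniq
  have hpde : ∀ x ∈ Ω, _ := fun x hx => pde_inner F hΩ hF x z e
    (derivWithin (X x) (Ioc 0 T) t) (V x (F x)) hx t (hsymF x hx) (fun k => by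
      rw [← hcomp x hx k, hFd]; exact heq x hx t ht k)
  have hpx := hpde x hx
  have hpy := hpde y hy
  have htime := time_test (fun τ => C x y τ) _ t ht0
    (by
      simp only [hCxy]
      have h1 := ((hXd y hy).sub (hXd x hx)).inner ℝ (hasDerivWithinAt_const t (Ioc 0 T) e)
      have h2 := (hψdt _ hs0' t ht).const_mul 2
      have h3 := (hasDerivWithinAt_id t (Ioc 0 T)).mul (h1.add h2)
      exact h3.mono (Ioc_subset_Ioc_right ht.2))
    (fun s hs => hmin x hx y hy s hs)
  simp only [id, Pi.sub_apply, Pi.add_apply, inner_zero_right, zero_add, inner_sub_left, one_mul, hFx,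
    hpx, hpy] at htime
  have hf1 := hfirst (F x) (F y)
  have hf2 := hfirst (x - z) (y - z)
  rw [show y - z - (x - z) = y - x by abel, hde, real_inner_smul_right, real_inner_smul_right,
    hee1] at hf2
  have hVe : 0 ≤ ⟪V y (F y), e⟫ - ⟪V x (F x), e⟫ := by
    have := hVexp t ht x hx y hy
    rw [hFx, hFx, hde, real_inner_smul_right, inner_sub_left] at this
    exact nonneg_of_mul_nonneg_right this hd
  have hCS : ⟪e, F y - F x⟫ * ⟪F y - F x, e⟫ ≤ ⟪F y - F x, F y - F x⟫ := by
    have h := real_inner_mul_inner_self_le (F y - F x) e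
    rw [hee1, mul_one] at h
    rwa [real_inner_comm]
  have hO := hODE _ hs0' t ht
  have hps := hψneg _ hs0 t ht
  rw [hCxy, hFx, hFx] at hneg
  have hZ : ⟪F y - F x, e⟫ + 2 * ψ (d / 2) t < 0 := by
    by_contra hcon
    push Not at hcon
    exact absurd hneg (not_lt.2 (mul_nonneg ht0.le hcon))
  have hCS' : 0 ≤ d⁻¹ * (⟪F y - F x, F y - F x⟫ - ⟪e, F y - F x⟫ * ⟪F y - F x, e⟫) :=
    mul_nonneg (inv_nonneg.2 hd.le) (sub_nonneg.2 hCS)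
  rw [real_inner_comm (F y - F x) e] at hf1 hCS'
  rw [inner_sub_left _ _ e] at hf1 hf2
  have hZ' := mul_pos_of_neg_of_neg hps hZ
  have hin : ⟪F y, e⟫ - ⟪F x, e⟫ = ⟪F y - F x, e⟫ := (inner_sub_left _ _ _).symm
  have hf2' : ⟪fderiv ℝ F y (y - z), e⟫ - ⟪fderiv ℝ F x (x - z), e⟫ = - (ψs (d/2) t * d) := by
    linear_combination hf2
  rw [ge_iff_le] at hO
  have hmul := mul_le_mul_of_nonneg_left hO ht0.le
  have ha : t * (2 * ψ (d/2) t * ψs (d/2) t - ψ (d/2) t / t - (d / 2 / t) * ψs (d/2) t)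
     = t * (2 * ψ (d/2) t * ψs (d/2) t) - ψ (d/2) t - d / 2 * ψs (d/2) t := by
    field_simp
  rw [ha] at hmul
  have m1 := mul_nonneg ht0.le htr
  have m2 := mul_nonneg ht0.le hVe
  have m3 := mul_nonneg ht0.le hCS'
  have m4 := mul_pos ht0 hZ'
  have m5 : t * (1 / t) = 1 := by field_simp
  exact final_algebra _ _ _ _ _ _ _ _ _ _ _ _ _ _ _ _ _ _ htime hf1 hf2' hin m1 m2 m3 m4 m5 hmul
end
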